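/- arXiv:math/0009182 — 5 statements merged into one kernel-verified Lean document; each statement's English description precedes it below -/
import Mathlib

section
/- For every real q > 1 and real u with 0 < u < 1, the quantities N_{u,q}(λ) sum to 1 over all partitions λ of all positive integers; that is, N_{u,q} defines a probability measure on the set of partitions of positive integers. -/
/-- `(x/q)_i = ∏_{j=1}^i (1 - x/q^j)`. -/
noncomputable def poch (x q : ℝ) (i : ℕ) : ℝ := ∏ j ∈ Finset.Icc 1 i, (1 - x / q ^ j)

/-- The `i`-th column length `λ'_i` of the partition whose multiset of parts is `m`:
the number of parts of size at least `i`. -/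
def col (m : Multiset ℕ) (i : ℕ) : ℕ := (m.filter (fun p => i ≤ p)).card

/-- The measure `N_{u,q}` on partitions (a partition is encoded by its multiset of parts):
`N_{u,q}(λ) = [∏_{r=1}^∞ (1 - u/q^r)] ⬝ u^{|λ|-1} (q^{λ'_1} - 1) / ∏_i q^{(λ'_i)²} (1/q)_{m_i(λ)}`. -/
noncomputable def Nmeas (u q : ℝ) (m : Multiset ℕ) : ℝ :=
  (∏' r : ℕ, (1 - u / q ^ (r + 1))) * u ^ (m.sum - 1) * (q ^ col m 1 - 1) /
    ∏ i ∈ Finset.Icc 1 m.sum, (q ^ ((col m i) ^ 2) * poch 1 q (m.count i))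

/-- `(x t; t)_k = ∏_{i=1}^k (1 - x t^i)`. -/
noncomputable def qPoch (x t : ℝ) (k : ℕ) : ℝ := ∏ i ∈ Finset.range k, (1 - x * t ^ (i + 1))

/-- The Gaussian binomial coefficient, defined by its Pascal recursion. -/
noncomputable def gaussBinom (t : ℝ) : ℕ → ℕ → ℝ
  | _, 0 => 1
  | 0, _ + 1 => 0
  | n + 1, k + 1 => gaussBinom t n (k + 1) + t ^ (n - k) * gaussBinom t n k

lemma gaussBinom_zero_right (t : ℝ) (n : ℕ) : gaussBinom t n 0 = 1 := by
  cases n <;> rfl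

lemma gaussBinom_succ_succ (t : ℝ) (n k : ℕ) :
    gaussBinom t (n + 1) (k + 1) = gaussBinom t n (k + 1) + t ^ (n - k) * gaussBinom t n k := rfl

lemma gaussBinom_eq_zero_of_lt (t : ℝ) {n k : ℕ} (h : n < k) : gaussBinom t n k = 0 := by
  induction n generalizing k with
  | zero => obtain ⟨k, rfl⟩ := Nat.exists_eq_succ_of_ne_zero h.ne'; rfl
  | succ n ih =>
    obtain ⟨k, rfl⟩ := Nat.exists_eq_succ_of_ne_zero (Nat.ne_zero_of_lt h)
    simp [gaussBinom, ih (show n < k + 1 by omega), ih (show n < k by omega)]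

lemma qPoch_zero (x t : ℝ) : qPoch x t 0 = 1 := by simp [qPoch]

lemma qPoch_succ (x t : ℝ) (k : ℕ) :
    qPoch x t (k + 1) = qPoch x t k * (1 - x * t ^ (k + 1)) := Finset.prod_range_succ ..

lemma qPoch_succ' (x t : ℝ) (k : ℕ) :
    qPoch x t (k + 1) = (1 - x * t) * qPoch (x * t) t k := by
  simp only [qPoch, Finset.prod_range_succ']
  rw [mul_comm]
  congr 1
  · simp
  · exact Finset.prod_congr rfl fun i _ => by ring

lemma gaussBinom_mul_qPoch (t : ℝ) (n j : ℕ) (h : j ≤ n) :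
    gaussBinom t n j * (qPoch 1 t j * qPoch 1 t (n - j)) = qPoch 1 t n := by
  induction n generalizing j with
  | zero => obtain rfl : j = 0 := by omega
            simp [gaussBinom, qPoch_zero]
  | succ n ih =>
    rcases j with _ | j
    · simp [gaussBinom_zero_right, qPoch_zero]
    have h₂ := ih j (by omega)
    rcases (show j ≤ n by omega).eq_or_lt with rfl | hj
    · simp only [gaussBinom, gaussBinom_eq_zero_of_lt t (Nat.lt_succ_self j), Nat.sub_self,
        qPoch_zero, qPoch_succ] at h₂ ⊢
      linear_combination (1 - 1 * t ^ (j + 1)) * h₂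
    · obtain ⟨i, rfl⟩ := Nat.exists_eq_add_of_lt hj
      have h₁ := ih (j + 1) (by omega)
      simp only [show j + i + 1 - (j + 1) = i by omega, show j + i + 1 - j = i + 1 by omega,
        show j + i + 1 + 1 - (j + 1) = i + 1 by omega, gaussBinom_succ_succ t (j + i + 1)] at h₁ h₂ ⊢
      rw [qPoch_succ 1 t (j + i + 1), ← h₂]
      have e : gaussBinom t (j + i + 1) (j + 1) * (qPoch 1 t (j + 1) * qPoch 1 t (i + 1))
          = (1 - t ^ (i + 1)) *
            (gaussBinom t (j + i + 1) j * (qPoch 1 t j * qPoch 1 t (i + 1))) := by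
        rw [h₂, ← h₁, qPoch_succ 1 t i]; ring
      rw [add_mul, e, qPoch_succ 1 t j]
      ring

/-- A terminating case of the `q`-Chu–Vandermonde identity. -/
lemma sum_gaussBinom_mul_prod (t u : ℝ) (k : ℕ) :
    ∑ j ∈ Finset.range (k + 1), gaussBinom t k j * (u ^ j * t ^ j ^ 2) *
      ∏ i ∈ Finset.Ico j k, (1 - u * t ^ (i + 1)) = 1 := by
  induction k generalizing u with
  | zero => simp [gaussBinom]
  | succ k ih =>
    have e₁ : ∑ j ∈ Finset.range (k + 2), gaussBinom t k j * (u ^ j * t ^ j ^ 2) *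
        ∏ i ∈ Finset.Ico j (k + 1), (1 - u * t ^ (i + 1)) = 1 - u * t ^ (k + 1) := by
      rw [Finset.sum_range_succ, gaussBinom_eq_zero_of_lt t (Nat.lt_succ_self k), zero_mul,
        zero_mul, add_zero]
      calc _ = ∑ j ∈ Finset.range (k + 1), gaussBinom t k j * (u ^ j * t ^ j ^ 2) *
            (∏ i ∈ Finset.Ico j k, (1 - u * t ^ (i + 1))) * (1 - u * t ^ (k + 1)) := by
            refine Finset.sum_congr rfl fun j hj => ?_
            rw [Finset.prod_Ico_succ_top (by simp at hj; omega)]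
            ring
        _ = _ := by rw [← Finset.sum_mul, ih u, one_mul]
    have e₂ : ∑ j ∈ Finset.range (k + 1), t ^ (k - j) * gaussBinom t k j *
        (u ^ (j + 1) * t ^ (j + 1) ^ 2) *
        ∏ i ∈ Finset.Ico (j + 1) (k + 1), (1 - u * t ^ (i + 1)) = u * t ^ (k + 1) := by
      calc _ = ∑ j ∈ Finset.range (k + 1), u * t ^ (k + 1) *
            (gaussBinom t k j * ((u * t) ^ j * t ^ j ^ 2) *
            (∏ i ∈ Finset.Ico j k, (1 - u * t * t ^ (i + 1)))) := by
            refine Finset.sum_congr rfl fun j hj => ?_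
            obtain ⟨i, rfl⟩ := Nat.exists_eq_add_of_le (show j ≤ k by simp at hj; omega)
            have : ∏ l ∈ Finset.Ico j (j + i), (1 - u * t * t ^ (l + 1)) =
                ∏ l ∈ Finset.Ico (j + 1) (j + i + 1), (1 - u * t ^ (l + 1)) := by
              rw [← Finset.prod_Ico_add' (fun l => 1 - u * t ^ (l + 1)) j (j + i) 1]
              exact Finset.prod_congr rfl fun l _ => by ring
            rw [this, Nat.add_sub_cancel_left]
            ring
        _ = _ := by rw [← Finset.mul_sum, ih (u * t), mul_one]
    rw [Finset.sum_range_succ'] at e₁ ⊢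
    simp only [gaussBinom, add_mul, Finset.sum_add_distrib]
    simp only [gaussBinom_zero_right] at e₁ e₂ ⊢
    linear_combination e₁ + e₂

section Positivity

variable {x t : ℝ}

lemma one_sub_mul_pow_pos (hx1 : x ≤ 1) (ht0 : 0 < t) (ht1 : t < 1) (i : ℕ) :
    0 < 1 - x * t ^ (i + 1) := by
  have h := pow_lt_one₀ ht0.le ht1 (Nat.succ_ne_zero i)
  have h' := mul_le_of_le_one_left (pow_pos ht0 (i + 1)).le hx1
  rw [Nat.succ_eq_add_one] at h
  linarith

lemma qPoch_pos (hx1 : x ≤ 1) (ht0 : 0 < t) (ht1 : t < 1) (k : ℕ) :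
    0 < qPoch x t k :=
  Finset.prod_pos fun i _ => one_sub_mul_pow_pos hx1 ht0 ht1 i

lemma qPoch_antitone (hx0 : 0 ≤ x) (hx1 : x ≤ 1) (ht0 : 0 < t) (ht1 : t < 1) :
    Antitone (qPoch x t) := by
  refine antitone_nat_of_succ_le fun k => ?_
  rw [qPoch_succ]
  have := qPoch_pos hx1 ht0 ht1 k
  have : 0 ≤ x * t ^ (k + 1) := by positivity
  nlinarith

lemma summable_mul_pow_succ (x : ℝ) (ht0 : 0 < t) (ht1 : t < 1) :
    Summable fun i : ℕ => ‖-(x * t ^ (i + 1))‖ := by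
  have : Summable fun i : ℕ => |x| * t * t ^ i :=
    (summable_geometric_of_lt_one ht0.le ht1).mul_left _
  refine this.congr fun i => ?_
  rw [norm_neg, norm_mul, norm_pow, Real.norm_eq_abs, Real.norm_eq_abs, abs_of_pos ht0]
  ring

lemma tendsto_qPoch (x : ℝ) (ht0 : 0 < t) (ht1 : t < 1) :
    Filter.Tendsto (qPoch x t) Filter.atTop (nhds (∏' i : ℕ, (1 - x * t ^ (i + 1)))) := by
  have h := multipliable_one_add_of_summable (summable_mul_pow_succ x ht0 ht1)
  simp only [← sub_eq_add_neg] at h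
  exact h.tendsto_prod_tprod_nat

lemma tprod_le_qPoch (hx0 : 0 ≤ x) (hx1 : x ≤ 1) (ht0 : 0 < t) (ht1 : t < 1) (k : ℕ) :
    ∏' i : ℕ, (1 - x * t ^ (i + 1)) ≤ qPoch x t k :=
  (qPoch_antitone hx0 hx1 ht0 ht1).le_of_tendsto (tendsto_qPoch x ht0 ht1) k

lemma tprod_one_sub_mul_pow_pos (hx1 : x ≤ 1) (ht0 : 0 < t) (ht1 : t < 1) :
    0 < ∏' i : ℕ, (1 - x * t ^ (i + 1)) := by
  have h := tprod_one_add_ne_zero_of_summable (f := fun i : ℕ => -(x * t ^ (i + 1)))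
    (fun i => by rw [← sub_eq_add_neg]; exact (one_sub_mul_pow_pos hx1 ht0 ht1 i).ne')
    (summable_mul_pow_succ x ht0 ht1)
  simp only [← sub_eq_add_neg] at h
  exact lt_of_le_of_ne (ge_of_tendsto' (tendsto_qPoch x ht0 ht1)
    fun k => (qPoch_pos hx1 ht0 ht1 k).le) h.symm

end Positivity

lemma sum_gaussBinom_div_qPoch {u t : ℝ} (hu0 : 0 < u) (hu1 : u < 1)
    (ht0 : 0 < t) (ht1 : t < 1)
    (k : ℕ) :
    ∑ j ∈ Finset.range (k + 1), gaussBinom t k j * (u ^ j * t ^ j ^ 2) / qPoch u t j =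
      1 / qPoch u t k := by
  have hk := qPoch_pos hu1.le ht0 ht1 k
  rw [eq_div_iff hk.ne', Finset.sum_mul, ← sum_gaussBinom_mul_prod t u k]
  refine Finset.sum_congr rfl fun j hj => ?_
  have hj' := qPoch_pos hu1.le ht0 ht1 j
  have : qPoch u t k = qPoch u t j * ∏ i ∈ Finset.Ico j k, (1 - u * t ^ (i + 1)) :=
    (Finset.prod_range_mul_prod_Ico _ (by simp at hj; omega)).symm
  rw [this]
  field_simp

lemma sum_div_qPoch_mul_qPoch {u t : ℝ} (hu0 : 0 < u) (hu1 : u < 1)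
    (ht0 : 0 < t) (ht1 : t < 1)
    (k : ℕ) :
    ∑ j ∈ Finset.range (k + 1),
      u ^ j * t ^ j ^ 2 / (qPoch 1 t j * qPoch u t j) / qPoch 1 t (k - j) =
      1 / (qPoch 1 t k * qPoch u t k) := by
  have hp := qPoch_pos le_rfl ht0 ht1
  rw [one_div, mul_inv, mul_comm, ← one_div, ← sum_gaussBinom_div_qPoch hu0 hu1 ht0 ht1 k,
    Finset.sum_mul]
  refine Finset.sum_congr rfl fun j hj => ?_
  have hj' := qPoch_pos hu1.le ht0 ht1 j
  rw [← gaussBinom_mul_qPoch t k j (by simp at hj; omega)]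
  have h₁ := hp j
  have h₂ := hp (k - j)
  have h₃ : gaussBinom t k j ≠ 0 := by
    intro h
    have := gaussBinom_mul_qPoch t k j (by simp at hj; omega)
    rw [h, zero_mul] at this
    exact (hp k).ne this
  field_simp

lemma hasSum_durfee {u t : ℝ} (hu0 : 0 < u) (hu1 : u < 1)
    (ht0 : 0 < t) (ht1 : t < 1) :
    HasSum (fun j : ℕ => u ^ j * t ^ j ^ 2 / (qPoch 1 t j * qPoch u t j))
      (1 / ∏' i : ℕ, (1 - u * t ^ (i + 1))) := by
  have hp := qPoch_pos le_rfl ht0 ht1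
  have hpu := qPoch_pos hu1.le ht0 ht1
  set A := ∏' i : ℕ, (1 - 1 * t ^ (i + 1)) with hA
  set B := ∏' i : ℕ, (1 - u * t ^ (i + 1)) with hB
  have hA0 : 0 < A := tprod_one_sub_mul_pow_pos le_rfl ht0 ht1
  have hB0 : 0 < B := tprod_one_sub_mul_pow_pos hu1.le ht0 ht1
  have hgb (k j : ℕ) (h : j ≤ k) :
      gaussBinom t k j = qPoch 1 t k / (qPoch 1 t j * qPoch 1 t (k - j)) := by
    rw [eq_div_iff (mul_pos (hp _) (hp _)).ne', gaussBinom_mul_qPoch t k j h]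
  have hbound : Summable fun j : ℕ => 1 / (A * B) * u ^ j :=
    (summable_geometric_of_lt_one hu0.le hu1).mul_left _
  have hterm (j : ℕ) : u ^ j * t ^ j ^ 2 / (qPoch 1 t j * qPoch u t j) ≤ 1 / (A * B) * u ^ j := by
    rw [one_div_mul_eq_div]
    have := hp j
    gcongr
    · exact mul_le_of_le_one_right (by positivity) (pow_le_one₀ ht0.le ht1.le)
    · exact tprod_le_qPoch zero_le_one le_rfl ht0 ht1 j
    · exact tprod_le_qPoch hu0.le hu1.le ht0 ht1 j
  have hsum : Summable fun j : ℕ => u ^ j * t ^ j ^ 2 / (qPoch 1 t j * qPoch u t j) :=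
    hbound.of_nonneg_of_le (fun j => by have := hp j; have := hpu j; positivity) hterm
  have htan := tendsto_tsum_of_dominated_convergence (𝓕 := Filter.atTop)
    (f := fun k j : ℕ => gaussBinom t k j * (u ^ j * t ^ j ^ 2) / qPoch u t j)
    (g := fun j : ℕ => u ^ j * t ^ j ^ 2 / (qPoch 1 t j * qPoch u t j)) hbound
    (fun j => by
      have h₁ := tendsto_qPoch 1 ht0 ht1
      have h₂ : Filter.Tendsto (fun k => qPoch 1 t (k - j)) Filter.atTop (nhds A) :=
        h₁.comp (Filter.tendsto_sub_atTop_nat j)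
      have h₃ := ((h₁.div h₂ hA0.ne').mul_const
        (u ^ j * t ^ j ^ 2 / (qPoch 1 t j * qPoch u t j)))
      rw [div_self hA0.ne', one_mul] at h₃
      refine h₃.congr' ?_
      filter_upwards [Filter.eventually_ge_atTop j] with k hk
      have := hp j
      have := hpu j
      have := hp (k - j)
      simp only [Pi.div_apply, hgb k j hk]
      field_simp)
    (Filter.Eventually.of_forall fun k j => by
      rcases lt_or_ge k j with h | h
      · simp only [gaussBinom_eq_zero_of_lt t h, zero_mul, zero_div, norm_zero]
        positivity
      · have := hp j
        have := hpu j
        have := hp (k - j)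
        have := hp k
        simp only [hgb k j h]
        rw [Real.norm_of_nonneg (by positivity)]
        refine le_trans ?_ (hterm j)
        have h₁ : qPoch 1 t k / qPoch 1 t (k - j) ≤ 1 :=
          (div_le_one (hp _)).2 (qPoch_antitone zero_le_one le_rfl ht0 ht1 (by omega))
        calc _ = qPoch 1 t k / qPoch 1 t (k - j) *
              (u ^ j * t ^ j ^ 2 / (qPoch 1 t j * qPoch u t j)) := by field_simp
          _ ≤ _ := mul_le_of_le_one_left (by positivity) h₁)
  have hfin (k : ℕ) : ∑' j : ℕ, gaussBinom t k j * (u ^ j * t ^ j ^ 2) / qPoch u t j =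
      1 / qPoch u t k := by
    rw [← sum_gaussBinom_div_qPoch hu0 hu1 ht0 ht1 k]
    refine tsum_eq_sum fun j hj => ?_
    rw [gaussBinom_eq_zero_of_lt t (by simp at hj; omega)]
    simp
  simp only [hfin] at htan
  have hlim : Filter.Tendsto (fun k => 1 / qPoch u t k) Filter.atTop (nhds (1 / B)) :=
    tendsto_const_nhds.div (tendsto_qPoch u ht0 ht1) hB0.ne'
  exact tendsto_nhds_unique htan hlim ▸ hsum.hasSum

/-- The shifted form of `hasSum_durfee`. -/
lemma hasSum_durfee_succ {u t : ℝ} (hu0 : 0 < u) (hu1 : u < 1)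
    (ht0 : 0 < t) (ht1 : t < 1) :
    HasSum (fun j : ℕ => u ^ j * t ^ (j ^ 2 + j) / (qPoch 1 t j * qPoch u t (j + 1)))
      (1 / ∏' i : ℕ, (1 - u * t ^ (i + 1))) := by
  have hut : u * t < 1 := by nlinarith
  have h := (hasSum_durfee (mul_pos hu0 ht0) hut ht0 ht1).div_const (1 - u * t)
  have hB : ∏' i : ℕ, (1 - u * t ^ (i + 1)) =
      (1 - u * t) * ∏' i : ℕ, (1 - u * t * t ^ (i + 1)) := by
    refine tendsto_nhds_unique ((tendsto_qPoch u ht0 ht1).comp (Filter.tendsto_add_atTop_nat 1)) ?_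
    refine ((tendsto_qPoch (u * t) ht0 ht1).const_mul (1 - u * t)).congr fun k => ?_
    exact (qPoch_succ' u t k).symm
  rw [hB]
  rw [div_div, mul_comm (∏' i : ℕ, (1 - u * t * t ^ (i + 1)))] at h
  refine Eq.mp (congrArg (fun f : ℕ → ℝ => HasSum f _) (funext fun j => ?_)) h
  rw [qPoch_succ', div_div]
  congr 1 <;> ring


/-- Partitions with exactly `k` parts, encoded by their multisets of (positive) parts. -/
def PartsEq (k : ℕ) : Type := {m : Multiset ℕ // (∀ x ∈ m, 0 < x) ∧ m.card = k}

/-- The partition whose first column has length `k` and whose remaining columns form `m`. -/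
def addColumn (k : ℕ) (m : Multiset ℕ) : Multiset ℕ :=
  Multiset.replicate (k - m.card) 1 + m.map (· + 1)

lemma card_addColumn {k : ℕ} {m : Multiset ℕ} (h : m.card ≤ k) : (addColumn k m).card = k := by
  simp [addColumn]; omega

lemma sum_addColumn {k : ℕ} {m : Multiset ℕ} (h : m.card ≤ k) :
    (addColumn k m).sum = k + m.sum := by
  simp [addColumn, Multiset.sum_map_add]; omega

lemma pos_of_mem_addColumn {k : ℕ} {m : Multiset ℕ} {x : ℕ} (hx : x ∈ addColumn k m) : 0 < x := by
  simp only [addColumn, Multiset.mem_add, Multiset.mem_map] at hx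
  rcases hx with h | ⟨y, -, rfl⟩
  · rw [Multiset.eq_of_mem_replicate h]; exact one_pos
  · omega

lemma filter_addColumn {k : ℕ} {m : Multiset ℕ} (hm : ∀ x ∈ m, 0 < x) :
    (addColumn k m).filter (fun x => 2 ≤ x) = m.map (· + 1) := by
  rw [addColumn, Multiset.filter_add, Multiset.filter_eq_nil.2, zero_add, Multiset.filter_eq_self]
  · intro x hx
    obtain ⟨y, hy, rfl⟩ := Multiset.mem_map.1 hx
    have := hm y hy
    omega
  · intro x hx
    rw [Multiset.eq_of_mem_replicate hx]
    omega

lemma exists_addColumn_eq {m : Multiset ℕ} (hm : ∀ x ∈ m, 0 < x) :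
    ∃ m' : Multiset ℕ, (∀ x ∈ m', 0 < x) ∧ m'.card ≤ m.card ∧ addColumn m.card m' = m := by
  have hsplit := Multiset.filter_add_not (fun x => 2 ≤ x) m
  have hone : m.filter (fun x => ¬ 2 ≤ x) =
      Multiset.replicate (m.filter (fun x => ¬ 2 ≤ x)).card 1 := by
    refine Multiset.eq_replicate_card.2 fun x hx => ?_
    obtain ⟨h₁, h₂⟩ := Multiset.mem_filter.1 hx
    have := hm x h₁
    omega
  have hcard := congrArg Multiset.card hsplit
  rw [Multiset.card_add] at hcard
  refine ⟨(m.filter (fun x => 2 ≤ x)).map (· - 1), fun x hx => ?_, ?_, ?_⟩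
  · obtain ⟨y, hy, rfl⟩ := Multiset.mem_map.1 hx
    have := (Multiset.mem_filter.1 hy).2
    omega
  · rw [Multiset.card_map]; omega
  · rw [addColumn, Multiset.card_map, Multiset.map_map]
    have : (m.filter (fun x => 2 ≤ x)).map ((· + 1) ∘ (· - 1)) = m.filter (fun x => 2 ≤ x) := by
      conv_rhs => rw [← Multiset.map_id (m.filter (fun x => 2 ≤ x))]
      refine Multiset.map_congr rfl fun x hx => ?_
      have := (Multiset.mem_filter.1 hx).2
      simp only [Function.comp_apply, id_eq]
      omega
    rw [this, show m.card - (m.filter (fun x => 2 ≤ x)).card =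
      (m.filter (fun x => ¬ 2 ≤ x)).card by omega, ← hone, add_comm, hsplit]

open scoped ENNReal in
/-- Sums over partitions with `k` parts decompose according to the length of the second column. -/
lemma tsum_partsEq (k : ℕ) (f : Multiset ℕ → ℝ≥0∞) :
    ∑' m : PartsEq k, f m.1 =
      ∑ j ∈ Finset.range (k + 1), ∑' m : PartsEq j, f (addColumn k m.1) := by
  let Φ : (Σ j : Fin (k + 1), PartsEq j) → PartsEq k := fun s =>
    ⟨addColumn k s.2.1, fun _ hx => pos_of_mem_addColumn hx,
      card_addColumn (s.2.2.2.trans_le (Nat.lt_succ_iff.1 s.1.2))⟩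
  have hΦ : Function.Bijective Φ := by
    constructor
    · rintro ⟨⟨i, hi⟩, m, hm, hi'⟩ ⟨⟨j, hj⟩, n, hn, hj'⟩ h
      have h' : addColumn k m = addColumn k n := congrArg Subtype.val h
      have h'' := congrArg (Multiset.filter (fun x => 2 ≤ x)) h'
      rw [filter_addColumn hm, filter_addColumn hn] at h''
      obtain rfl := Multiset.map_injective (add_left_injective 1) h''
      obtain rfl : i = j := hi'.symm.trans hj'
      rfl
    · rintro ⟨m, hm, rfl⟩
      obtain ⟨m', h₁, h₂, h₃⟩ := exists_addColumn_eq hm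
      exact ⟨⟨⟨m'.card, Nat.lt_succ_of_le h₂⟩, ⟨m', h₁, rfl⟩⟩, Subtype.ext h₃⟩
  rw [← (Equiv.ofBijective Φ hΦ).tsum_eq, ENNReal.tsum_sigma', tsum_fintype,
    Finset.sum_range fun j => ∑' m : PartsEq j, f (addColumn k m.1)]
  rfl

/-- The weight `u^|λ| / ∏_i q^{(λ'_i)²} (1/q)_{m_i(λ)}`. -/
noncomputable def colWeight (u q : ℝ) (m : Multiset ℕ) : ℝ :=
  u ^ m.sum / ∏ i ∈ Finset.Icc 1 m.sum, (q ^ ((col m i) ^ 2) * poch 1 q (m.count i))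

lemma prod_Icc_one_eq_prod_range {M : Type*} [CommMonoid M] (f : ℕ → M) (n : ℕ) :
    ∏ i ∈ Finset.Icc 1 n, f i = ∏ i ∈ Finset.range n, f (i + 1) := by
  rw [← Finset.Ico_succ_right_eq_Icc, Finset.prod_Ico_eq_prod_range]
  exact Finset.prod_congr (by simp) fun i _ => by rw [add_comm]

lemma poch_eq_qPoch (x q : ℝ) (k : ℕ) : poch x q k = qPoch x q⁻¹ k := by
  rw [poch, qPoch, prod_Icc_one_eq_prod_range]
  simp only [div_eq_mul_inv, inv_pow]

lemma col_one {m : Multiset ℕ} (hm : ∀ x ∈ m, 0 < x) : col m 1 = m.card := by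
  exact congrArg Multiset.card (Multiset.filter_eq_self.2 hm)

lemma col_eq_zero {m : Multiset ℕ} {i : ℕ} (h : m.sum < i) : col m i = 0 := by
  rw [col, Multiset.card_eq_zero, Multiset.filter_eq_nil]
  intro x hx
  have := Multiset.le_sum_of_mem hx
  omega

lemma count_eq_zero_of_sum_lt {m : Multiset ℕ} {i : ℕ} (h : m.sum < i) : m.count i = 0 := by
  rw [Multiset.count_eq_zero]
  intro hi
  have := Multiset.le_sum_of_mem hi
  omega

lemma prod_columns_eq (q : ℝ) (m : Multiset ℕ) {N : ℕ} (h : m.sum ≤ N) :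
    ∏ i ∈ Finset.Icc 1 m.sum, (q ^ ((col m i) ^ 2) * poch 1 q (m.count i)) =
      ∏ i ∈ Finset.range N, (q ^ ((col m (i + 1)) ^ 2) * poch 1 q (m.count (i + 1))) := by
  rw [prod_Icc_one_eq_prod_range]
  refine Finset.prod_subset (Finset.range_subset_range.2 h) fun i _ hi => ?_
  have hi : m.sum < i + 1 := by simp at hi; omega
  simp [col_eq_zero hi, count_eq_zero_of_sum_lt hi, poch]

lemma col_addColumn_succ (k : ℕ) (m : Multiset ℕ) (i : ℕ) :
    col (addColumn k m) (i + 2) = col m (i + 1) := by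
  rw [col, addColumn, Multiset.filter_add, Multiset.filter_eq_nil.2, zero_add, Multiset.filter_map,
    Multiset.card_map, col]
  · congr 1
    exact Multiset.filter_congr fun x _ => by simp
  · intro x hx
    rw [Multiset.eq_of_mem_replicate hx]
    omega

lemma count_addColumn_succ (k : ℕ) (m : Multiset ℕ) (i : ℕ) :
    (addColumn k m).count (i + 2) = m.count (i + 1) := by
  rw [addColumn, Multiset.count_add, Multiset.count_eq_zero_of_notMem, zero_add]
  · exact Multiset.count_map_eq_count' (· + 1) m (add_left_injective 1) (i + 1)
  · intro h
    have := Multiset.eq_of_mem_replicate h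
    omega

lemma count_addColumn_one (k : ℕ) {m : Multiset ℕ} (hm : ∀ x ∈ m, 0 < x) :
    (addColumn k m).count 1 = k - m.card := by
  rw [addColumn, Multiset.count_add, Multiset.count_replicate_self,
    Multiset.count_eq_zero_of_notMem, add_zero]
  intro h
  obtain ⟨y, hy, h⟩ := Multiset.mem_map.1 h
  have := hm y hy
  omega

lemma colWeight_addColumn (u q : ℝ) {k : ℕ} {m : Multiset ℕ} (hm : ∀ x ∈ m, 0 < x)
    (h : m.card ≤ k) (hk : 0 < k) :
    colWeight u q (addColumn k m) =
      u ^ k * q⁻¹ ^ k ^ 2 / qPoch 1 q⁻¹ (k - m.card) * colWeight u q m := by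
  have hs := sum_addColumn h
  rw [colWeight, colWeight, prod_columns_eq q (addColumn k m) le_rfl,
    prod_columns_eq q m (N := k + m.sum - 1) (by omega), hs,
    show k + m.sum = (k + m.sum - 1) + 1 by omega, Finset.prod_range_succ', Nat.add_sub_cancel]
  simp only [col_addColumn_succ, count_addColumn_succ, zero_add, add_assoc, Nat.reduceAdd]
  rw [col_one fun _ => pos_of_mem_addColumn, card_addColumn h, count_addColumn_one k hm,
    poch_eq_qPoch, show k + m.sum - 1 + 1 = k + m.sum by omega, pow_add, inv_pow]
  simp only [div_eq_mul_inv, mul_inv]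
  ring

lemma colWeight_zero (u q : ℝ) : colWeight u q 0 = 1 := by simp [colWeight]

lemma colWeight_nonneg {u q : ℝ} (hu0 : 0 < u) (hq : 1 < q) (m : Multiset ℕ) :
    0 ≤ colWeight u q m := by
  have hp := qPoch_pos le_rfl (inv_pos.2 (one_pos.trans hq)) (inv_lt_one_of_one_lt₀ hq)
  refine div_nonneg (pow_nonneg hu0.le _) (Finset.prod_nonneg fun i _ => ?_)
  have := hp (m.count i)
  have := one_pos.trans hq
  rw [poch_eq_qPoch]
  positivity

open scoped ENNReal in
lemma tsum_partsEq_zero (f : Multiset ℕ → ℝ≥0∞) : ∑' m : PartsEq 0, f m.1 = f 0 := by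
  let e : PartsEq 0 := ⟨0, by simp, rfl⟩
  refine tsum_eq_single e fun m hm => absurd (Subtype.ext ?_) hm
  exact Multiset.card_eq_zero.1 m.2.2

/-- The total weight of the partitions with exactly `k` parts. -/
noncomputable def firstColWeight (u t : ℝ) (k : ℕ) : ℝ :=
  u ^ k * t ^ k ^ 2 / (qPoch 1 t k * qPoch u t k)

lemma firstColWeight_pos {u q : ℝ} (hq : 1 < q) (hu0 : 0 < u) (hu1 : u < 1)
    (k : ℕ) : 0 < firstColWeight u q⁻¹ k := by
  have ht0 : 0 < q⁻¹ := inv_pos.2 (one_pos.trans hq)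
  have ht1 : q⁻¹ < 1 := inv_lt_one_of_one_lt₀ hq
  have := qPoch_pos le_rfl ht0 ht1 k
  have := qPoch_pos hu1.le ht0 ht1 k
  unfold firstColWeight
  positivity

lemma firstColWeight_coeff_nonneg {u q : ℝ} (hq : 1 < q) (hu0 : 0 < u)
    (k i : ℕ) : 0 ≤ u ^ k * q⁻¹ ^ k ^ 2 / qPoch 1 q⁻¹ i := by
  have ht0 : 0 < q⁻¹ := inv_pos.2 (one_pos.trans hq)
  have := qPoch_pos le_rfl ht0 (inv_lt_one_of_one_lt₀ hq) i
  positivity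

lemma firstColWeight_eq_sum {u q : ℝ} (hq : 1 < q) (hu0 : 0 < u) (hu1 : u < 1)
    (k : ℕ) :
    firstColWeight u q⁻¹ k = ∑ j ∈ Finset.range (k + 1),
      u ^ k * q⁻¹ ^ k ^ 2 / qPoch 1 q⁻¹ (k - j) * firstColWeight u q⁻¹ j := by
  have h := sum_div_qPoch_mul_qPoch hu0 hu1 (inv_pos.2 (one_pos.trans hq))
    (inv_lt_one_of_one_lt₀ hq) k
  rw [firstColWeight, div_eq_mul_one_div, ← h, Finset.mul_sum]
  refine Finset.sum_congr rfl fun j _ => ?_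
  rw [firstColWeight]
  ring

lemma ofReal_firstColWeight_eq_sum {u q : ℝ} (hq : 1 < q) (hu0 : 0 < u) (hu1 : u < 1)
    (k : ℕ) :
    ENNReal.ofReal (firstColWeight u q⁻¹ k) = ∑ j ∈ Finset.range (k + 1),
      ENNReal.ofReal (u ^ k * q⁻¹ ^ k ^ 2 / qPoch 1 q⁻¹ (k - j)) *
        ENNReal.ofReal (firstColWeight u q⁻¹ j) := by
  rw [firstColWeight_eq_sum hq hu0 hu1, ENNReal.ofReal_sum_of_nonneg]
  · exact Finset.sum_congr rfl fun j _ =>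
      ENNReal.ofReal_mul (firstColWeight_coeff_nonneg hq hu0 k (k - j))
  · exact fun j _ => mul_nonneg (firstColWeight_coeff_nonneg hq hu0 k (k - j))
      (firstColWeight_pos hq hu0 hu1 j).le

lemma ofReal_colWeight_addColumn {u q : ℝ} (hq : 1 < q) (hu0 : 0 < u)
    {k j : ℕ} (hk : 0 < k) (hj : j ≤ k) (m : PartsEq j) :
    ENNReal.ofReal (colWeight u q (addColumn k m.1)) =
      ENNReal.ofReal (u ^ k * q⁻¹ ^ k ^ 2 / qPoch 1 q⁻¹ (k - j)) *
        ENNReal.ofReal (colWeight u q m.1) := by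
  rw [colWeight_addColumn u q m.2.1 (m.2.2.trans_le hj) hk, m.2.2,
    ENNReal.ofReal_mul (firstColWeight_coeff_nonneg hq hu0 k (k - j))]

lemma tsum_colWeight_bounded_parts_le {u q : ℝ} (hq : 1 < q) (hu0 : 0 < u) (hu1 : u < 1)
    (n k : ℕ) :
    ∑' m : PartsEq k, (if ∀ x ∈ m.1, x ≤ n then ENNReal.ofReal (colWeight u q m.1) else 0) ≤
      ENNReal.ofReal (firstColWeight u q⁻¹ k) := by
  rcases Nat.eq_zero_or_pos k with rfl | hk
  · rw [tsum_partsEq_zero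
      (fun m => if ∀ x ∈ m, x ≤ n then ENNReal.ofReal (colWeight u q m) else 0)]
    simp [colWeight_zero, firstColWeight, qPoch_zero]
  induction n generalizing k with
  | zero =>
    refine (ENNReal.tsum_eq_zero.2 fun m => if_neg fun h => ?_).trans_le zero_le
    obtain ⟨x, hx⟩ := Multiset.card_pos_iff_exists_mem.1 (m.2.2.symm ▸ hk)
    exact absurd (m.2.1 x hx) (h x hx).not_gt
  | succ n ih =>
    rw [tsum_partsEq k
      (fun m => if ∀ x ∈ m, x ≤ n + 1 then ENNReal.ofReal (colWeight u q m) else 0),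
      ofReal_firstColWeight_eq_sum hq hu0 hu1]
    refine Finset.sum_le_sum fun j hj => ?_
    have hj : j ≤ k := by simpa [Nat.lt_succ_iff] using hj
    have hle : ∑' m : PartsEq j,
        (if ∀ x ∈ m.1, x ≤ n then ENNReal.ofReal (colWeight u q m.1) else 0) ≤
        ENNReal.ofReal (firstColWeight u q⁻¹ j) := by
      rcases Nat.eq_zero_or_pos j with rfl | hj0
      · rw [tsum_partsEq_zero
          (fun m => if ∀ x ∈ m, x ≤ n then ENNReal.ofReal (colWeight u q m) else 0)]
        simp [colWeight_zero, firstColWeight, qPoch_zero]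
      · exact ih j hj0
    refine le_trans ?_ (mul_le_mul_right hle _)
    rw [← ENNReal.tsum_mul_left]
    refine ENNReal.tsum_le_tsum fun m => ?_
    split_ifs with h₁ h₂
    · exact (ofReal_colWeight_addColumn hq hu0 hk hj m).le
    · refine absurd (fun x hx => ?_) h₂
      have := h₁ (x + 1) (Multiset.mem_add.2 (Or.inr (Multiset.mem_map_of_mem _ hx)))
      omega
    · exact zero_le
    · exact zero_le

lemma tsum_colWeight_le {u q : ℝ} (hq : 1 < q) (hu0 : 0 < u) (hu1 : u < 1)
    (k : ℕ) :
    ∑' m : PartsEq k, ENNReal.ofReal (colWeight u q m.1) ≤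
      ENNReal.ofReal (firstColWeight u q⁻¹ k) := by
  rw [ENNReal.tsum_eq_iSup_sum]
  refine iSup_le fun s => ?_
  refine le_trans ?_ (tsum_colWeight_bounded_parts_le hq hu0 hu1 (s.sup fun m => m.1.sum) k)
  refine le_trans (Finset.sum_le_sum fun m hm => ?_) (ENNReal.sum_le_tsum s)
  rw [if_pos fun x hx => (Multiset.le_sum_of_mem hx).trans
    (Finset.le_sup (f := fun m : PartsEq k => m.1.sum) hm)]

lemma tsum_colWeight {u q : ℝ} (hq : 1 < q) (hu0 : 0 < u) (hu1 : u < 1)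
    (k : ℕ) :
    ∑' m : PartsEq k, ENNReal.ofReal (colWeight u q m.1) =
      ENNReal.ofReal (firstColWeight u q⁻¹ k) := by
  induction k using Nat.strong_induction_on with
  | _ k ih =>
    rcases Nat.eq_zero_or_pos k with rfl | hk
    · rw [tsum_partsEq_zero (fun m => ENNReal.ofReal (colWeight u q m))]
      simp [colWeight_zero, firstColWeight, qPoch_zero]
    have hrec : ∑' m : PartsEq k, ENNReal.ofReal (colWeight u q m.1) =
        ∑ j ∈ Finset.range (k + 1), ENNReal.ofReal (u ^ k * q⁻¹ ^ k ^ 2 / qPoch 1 q⁻¹ (k - j)) *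
          ∑' m : PartsEq j, ENNReal.ofReal (colWeight u q m.1) := by
      rw [tsum_partsEq k (fun m => ENNReal.ofReal (colWeight u q m))]
      refine Finset.sum_congr rfl fun j hj => ?_
      rw [← ENNReal.tsum_mul_left]
      exact tsum_congr fun m => ofReal_colWeight_addColumn hq hu0 hk
        (by simpa [Nat.lt_succ_iff] using hj) m
    have hle := tsum_colWeight_le hq hu0 hu1 k
    set c := u ^ k * q⁻¹ ^ k ^ 2 with hc
    have ht0 : 0 < q⁻¹ := inv_pos.2 (one_pos.trans hq)
    have hc0 : 0 ≤ c := by positivity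
    have hc1 : c < 1 := mul_lt_one_of_nonneg_of_lt_one_left (by positivity)
      (pow_lt_one₀ hu0.le hu1 hk.ne') (pow_le_one₀ ht0.le (inv_le_one_of_one_le₀ hq.le))
    have hG := ofReal_firstColWeight_eq_sum hq hu0 hu1 k
    rw [Finset.sum_range_succ, Nat.sub_self, qPoch_zero, div_one] at hrec hG
    rw [Finset.sum_congr rfl fun j hj => by rw [ih j (Finset.mem_range.1 hj)]] at hrec
    generalize ∑' m : PartsEq k, ENNReal.ofReal (colWeight u q m.1) = h at hrec hle ⊢
    rw [← hc] at hG
    generalize ∑ j ∈ Finset.range k, ENNReal.ofReal (c / qPoch 1 q⁻¹ (k - j)) *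
      ENNReal.ofReal (firstColWeight u q⁻¹ j) = S at hrec hG
    have hh : h ≠ ⊤ := ne_top_of_le_ne_top ENNReal.ofReal_ne_top hle
    have hS : S ≠ ⊤ := ne_top_of_le_ne_top ENNReal.ofReal_ne_top (hG ▸ le_self_add)
    have h₁ := congrArg ENNReal.toReal hrec
    have h₂ := congrArg ENNReal.toReal hG
    rw [ENNReal.toReal_add hS (ENNReal.mul_ne_top ENNReal.ofReal_ne_top hh), ENNReal.toReal_mul,
      ENNReal.toReal_ofReal hc0] at h₁
    rw [ENNReal.toReal_add hS (ENNReal.mul_ne_top ENNReal.ofReal_ne_top ENNReal.ofReal_ne_top),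
      ENNReal.toReal_mul, ENNReal.toReal_ofReal hc0] at h₂
    rw [← ENNReal.toReal_eq_toReal_iff' hh ENNReal.ofReal_ne_top]
    refine mul_left_cancel₀ (sub_pos.2 hc1).ne' ?_
    linear_combination h₁ - h₂

open scoped ENNReal in
/-- Sums over nonempty partitions decompose according to the number of parts. -/
lemma tsum_nonempty_partitions (f : Multiset ℕ → ℝ≥0∞) :
    ∑' P : {m : Multiset ℕ // (∀ x ∈ m, 0 < x) ∧ m ≠ 0}, f P.1 =
      ∑' k : ℕ, ∑' m : PartsEq (k + 1), f m.1 := by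
  let Ψ : (Σ k : ℕ, PartsEq (k + 1)) → {m : Multiset ℕ // (∀ x ∈ m, 0 < x) ∧ m ≠ 0} := fun s =>
    ⟨s.2.1, s.2.2.1, fun h => by
      have := s.2.2.2
      rw [h, Multiset.card_zero] at this
      omega⟩
  have hΨ : Function.Bijective Ψ := by
    constructor
    · rintro ⟨i, m, hm, hi⟩ ⟨j, n, hn, hj⟩ h
      obtain rfl : m = n := congrArg Subtype.val h
      obtain rfl : i = j := Nat.succ_injective (hi.symm.trans hj)
      rfl
    · rintro ⟨m, hm, h0⟩
      obtain ⟨k, hk⟩ := Nat.exists_eq_succ_of_ne_zero (mt Multiset.card_eq_zero.1 h0)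
      exact ⟨⟨k, m, hm, hk⟩, rfl⟩
  rw [← (Equiv.ofBijective Ψ hΨ).tsum_eq, ENNReal.tsum_sigma']
  rfl

lemma Nmeas_eq {u q : ℝ} (hu0 : 0 < u) {m : Multiset ℕ} (hm : ∀ x ∈ m, 0 < x) (h0 : m ≠ 0) :
    Nmeas u q m = (∏' r : ℕ, (1 - u * q⁻¹ ^ (r + 1))) * u⁻¹ * (q ^ m.card - 1) *
      colWeight u q m := by
  have hs : 0 < m.sum := by
    obtain ⟨x, hx⟩ := Multiset.exists_mem_of_ne_zero h0
    exact (hm x hx).trans_le (Multiset.le_sum_of_mem hx)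
  obtain ⟨s, hs⟩ := Nat.exists_eq_succ_of_ne_zero hs.ne'
  rw [Nmeas, colWeight, col_one hm]
  simp only [hs, Nat.succ_eq_add_one, Nat.add_sub_cancel, inv_pow, ← div_eq_mul_inv, pow_succ u]
  field_simp

/-- For `q > 1` and `0 < u < 1`, the quantities `N_{u,q}(λ)` sum to `1` over all
partitions `λ` of all positive integers. -/
theorem Nmeas_isProbabilityMeasure (q u : ℝ) (hq : 1 < q) (hu0 : 0 < u) (hu1 : u < 1) :
    HasSum (fun P : {m : Multiset ℕ // (∀ x ∈ m, 0 < x) ∧ m ≠ 0} => Nmeas u q P.1) 1 := by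
  have hq0 : 0 < q := one_pos.trans hq
  have ht0 : 0 < q⁻¹ := inv_pos.2 hq0
  have ht1 : q⁻¹ < 1 := inv_lt_one_of_one_lt₀ hq
  set B := ∏' r : ℕ, (1 - u * q⁻¹ ^ (r + 1)) with hB
  have hB0 : 0 < B := tprod_one_sub_mul_pow_pos hu1.le ht0 ht1
  have hD (k : ℕ) : 0 ≤ B * u⁻¹ * (q ^ k - 1) :=
    mul_nonneg (by positivity) (sub_nonneg.2 (one_le_pow₀ hq.le))
  have hterm (k : ℕ) :
      ∑' m : PartsEq (k + 1), ENNReal.ofReal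
        (B * u⁻¹ * (q ^ m.1.card - 1) * colWeight u q m.1) =
      ENNReal.ofReal (B * (u ^ k * q⁻¹ ^ (k ^ 2 + k) /
        (qPoch 1 q⁻¹ k * qPoch u q⁻¹ (k + 1)))) := by
    have hpos := one_sub_mul_pow_pos le_rfl ht0 ht1 k
    have hp := qPoch_pos le_rfl ht0 ht1 k
    have hpu := qPoch_pos hu1.le ht0 ht1 (k + 1)
    have hqk : q ^ (k + 1) - 1 = q ^ (k + 1) * (1 - 1 * q⁻¹ ^ (k + 1)) := by
      rw [inv_pow]
      field_simp
    have hexp : q⁻¹ ^ (k + 1) ^ 2 * q ^ (k + 1) = q⁻¹ ^ (k ^ 2 + k) := by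
      rw [show (k + 1) ^ 2 = (k ^ 2 + k) + (k + 1) by ring, pow_add _ (k ^ 2 + k), mul_assoc,
        ← mul_pow, inv_mul_cancel₀ hq0.ne', one_pow, mul_one]
    calc _ = ∑' m : PartsEq (k + 1), ENNReal.ofReal (B * u⁻¹ * (q ^ (k + 1) - 1)) *
          ENNReal.ofReal (colWeight u q m.1) :=
          tsum_congr fun m => by rw [m.2.2, ENNReal.ofReal_mul (hD (k + 1))]
      _ = _ := by
        rw [ENNReal.tsum_mul_left, tsum_colWeight hq hu0 hu1, ← ENNReal.ofReal_mul (hD (k + 1)),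
          firstColWeight, qPoch_succ 1, hqk, ← hexp]
        congr 1
        generalize 1 - 1 * q⁻¹ ^ (k + 1) = a at hpos ⊢
        generalize q⁻¹ ^ (k + 1) ^ 2 = b
        field_simp
        rw [pow_succ u]
        ring
  have hsum : HasSum (fun k : ℕ => B * (u ^ k * q⁻¹ ^ (k ^ 2 + k) /
      (qPoch 1 q⁻¹ k * qPoch u q⁻¹ (k + 1)))) 1 := by
    have := (hasSum_durfee_succ hu0 hu1 ht0 ht1).mul_left B
    rwa [← hB, mul_one_div_cancel hB0.ne'] at this
  have htotal : ∑' P : {m : Multiset ℕ // (∀ x ∈ m, 0 < x) ∧ m ≠ 0},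
      ENNReal.ofReal (B * u⁻¹ * (q ^ P.1.card - 1) * colWeight u q P.1) = 1 := by
    rw [tsum_nonempty_partitions
      (fun m => ENNReal.ofReal (B * u⁻¹ * (q ^ m.card - 1) * colWeight u q m)),
      tsum_congr hterm, ← ENNReal.ofReal_tsum_of_nonneg _ hsum.summable, hsum.tsum_eq,
      ENNReal.ofReal_one]
    intro k
    have := qPoch_pos le_rfl ht0 ht1 k
    have := qPoch_pos hu1.le ht0 ht1 (k + 1)
    positivity
  have h := ENNReal.hasSum_toReal (htotal ▸ ENNReal.one_ne_top)
  rw [← ENNReal.tsum_toReal_eq fun _ => ENNReal.ofReal_ne_top, htotal, ENNReal.toReal_one] at h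
  refine Eq.mp (congrArg (fun f => HasSum f (1 : ℝ)) (funext fun P => ?_)) h
  rw [Nmeas_eq hu0 P.2.1 P.2.2,
    ENNReal.toReal_ofReal (mul_nonneg (hD _) (colWeight_nonneg hu0 hq _))]
end

section
/- Fix real q > 1, real u with 0 < u < 1, and an integer k ≥ 1. Then the sum of N_{u,q}(λ) over all partitions λ of positive integers having exactly k parts (i.e. λ'_1 = k) equals u^{k−1} / |A(k−1,q)| · ∏_{r=k+1}^∞ (1 − u/q^r), where |A(k−1,q)| = q^{k−1} · ∏_{i=0}^{k−2} (q^{k−1} − q^i) (so |A(0,q)| = 1). -/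
/-- `|A(k-1,q)| = q^{k-1} ∏_{i=0}^{k-2} (q^{k-1} - q^i)`, as a real number. -/
noncomputable def affOrder (q : ℝ) (k : ℕ) : ℝ :=
  q ^ (k - 1) * ∏ i ∈ Finset.range (k - 1), (q ^ (k - 1) - q ^ i)

lemma poch_zero (x q : ℝ) : poch x q 0 = 1 := by simp [poch]

lemma poch_succ (x q : ℝ) (i : ℕ) : poch x q (i + 1) = poch x q i * (1 - x / q ^ (i + 1)) := by
  simp [poch, Finset.prod_Icc_succ_top]

lemma poch_succ' (x q : ℝ) (i : ℕ) : poch x q (i + 1) = (1 - x / q) * poch (x / q) q i := by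
  induction i with
  | zero => simp [poch]
  | succ i ih =>
    rw [poch_succ, ih, poch_succ, div_div, ← pow_succ']
    ring

lemma poch_eq_prod_range (x q : ℝ) (i : ℕ) :
    poch x q i = ∏ j ∈ Finset.range i, (1 - x / q ^ (j + 1)) := by
  induction i with
  | zero => simp [poch]
  | succ i ih => rw [poch_succ, ih, Finset.prod_range_succ]

lemma poch_pos {x q : ℝ} (hq : 1 < q) (hx : x ≤ 1) (i : ℕ) : 0 < poch x q i := by
  refine Finset.prod_pos fun j hj => ?_
  have hj' : j ≠ 0 := by have := Finset.mem_Icc.1 hj; omega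
  have h1 : 1 < q ^ j := one_lt_pow₀ hq hj'
  rw [sub_pos, div_lt_one (by linarith)]
  linarith

/-- A `q`-Chu–Vandermonde summation. -/
lemma sum_pow_div_poch {q : ℝ} (hq : 1 < q) (k : ℕ) :
    ∀ u : ℝ, 0 < u → u ≤ 1 →
    ∑ j ∈ Finset.range (k + 1),
      u ^ j / (q ^ (j ^ 2) * poch 1 q j * poch u q j * poch 1 q (k - j)) =
    1 / (poch 1 q k * poch u q k) := by
  have hq0 : 0 < q := by linarith
  induction k with
  | zero => intro u _ _; simp [poch_zero]
  | succ k ih =>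
    intro u hu0 hu1
    have hP := fun i => (poch_pos hq le_rfl i).ne'
    have hPu := fun i => (poch_pos hq hu1 i).ne'
    have huq0 : 0 < u / q := div_pos hu0 hq0
    have huq1 : u / q ≤ 1 := by rw [div_le_one hq0]; linarith
    have hPuq := fun i => (poch_pos hq huq1 i).ne'
    have hfac : ∀ i, 1 - 1 / q ^ (i + 1) ≠ 0 := fun i => by
      have := hP (i + 1); rw [poch_succ] at this; exact right_ne_zero_of_mul this
    have hufac : ∀ i, 1 - u / q ^ (i + 1) ≠ 0 := fun i => by
      have := hPu (i + 1); rw [poch_succ] at this; exact right_ne_zero_of_mul this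
    have hu' : 1 - u / q ≠ 0 := by simpa using hufac 0
    set t : ℕ → ℝ := fun j =>
      u ^ j / (q ^ (j ^ 2) * poch 1 q j * poch u q j * poch 1 q (k + 1 - j)) with ht
    have hsplit : (1 - 1 / q ^ (k + 1)) * ∑ j ∈ Finset.range (k + 1 + 1), t j =
        ∑ j ∈ Finset.range (k + 1 + 1), (1 - 1 / q ^ (k + 1 - j)) * t j +
        ∑ j ∈ Finset.range (k + 1 + 1), (1 / q ^ (k + 1 - j)) * (1 - 1 / q ^ j) * t j := by
      rw [← Finset.sum_add_distrib, Finset.mul_sum]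
      refine Finset.sum_congr rfl fun j hj => ?_
      have hj' : j ≤ k + 1 := by have := Finset.mem_range.1 hj; omega
      have : q ^ (k + 1) = q ^ (k + 1 - j) * q ^ j := by rw [← pow_add]; congr 1; omega
      rw [this]
      field_simp
      ring
    have hfirst : ∑ j ∈ Finset.range (k + 1 + 1), (1 - 1 / q ^ (k + 1 - j)) * t j =
        1 / (poch 1 q k * poch u q k) := by
      rw [Finset.sum_range_succ, ← ih u hu0 hu1]
      simp only [Nat.sub_self, pow_zero, div_one, sub_self, zero_mul, add_zero]
      refine Finset.sum_congr rfl fun j hj => ?_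
      have hj' : j ≤ k := by have := Finset.mem_range.1 hj; omega
      have e : k + 1 - j = (k - j) + 1 := by omega
      simp only [ht, e, poch_succ]
      have h1 := hP j
      have h2 := hPu j
      have h3 := hP (k - j)
      have h4 := hfac (k - j)
      generalize 1 - 1 / q ^ (k - j + 1) = X at *
      field_simp
    have hsecond : ∑ j ∈ Finset.range (k + 1 + 1),
        (1 / q ^ (k + 1 - j)) * (1 - 1 / q ^ j) * t j =
        u / q ^ (k + 1) / (1 - u / q) * (1 / (poch 1 q k * poch (u / q) q k)) := by
      rw [Finset.sum_range_succ', ← ih (u / q) huq0 huq1, Finset.mul_sum]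
      simp only [pow_zero, div_one, sub_self, zero_mul, mul_zero, add_zero]
      refine Finset.sum_congr rfl fun j hj => ?_
      have hj' : j ≤ k := by have := Finset.mem_range.1 hj; omega
      have e : k + 1 - (j + 1) = k - j := by omega
      have e2 : q ^ (k + 1) = q ^ (k - j) * q ^ (j + 1) := by rw [← pow_add]; congr 1; omega
      simp only [ht, e, poch_succ 1, poch_succ' u, e2, div_pow]
      have h1 := hP j
      have h2 := hPuq j
      have h3 := hP (k - j)
      have h4 := hfac j
      generalize 1 - 1 / q ^ (j + 1) = X at *
      generalize 1 - u / q = Y at *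
      field_simp
      ring
    have hR : (1 - 1 / q ^ (k + 1)) * ∑ j ∈ Finset.range (k + 1 + 1), t j =
        (1 - 1 / q ^ (k + 1)) * (1 / (poch 1 q (k + 1) * poch u q (k + 1))) := by
      rw [hsplit, hfirst, hsecond]
      have a1 : poch (u / q) q k = poch u q (k + 1) / (1 - u / q) := by
        rw [poch_succ', mul_div_cancel_left₀ _ hu']
      rw [a1, poch_succ 1, poch_succ u]
      have h1 := hP k
      have h2 := hPu k
      have h4 := hfac k
      have h5 := hufac k
      generalize 1 - 1 / q ^ (k + 1) = X at *
      generalize u / q ^ (k + 1) = Z at *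
      generalize 1 - u / q = Y at *
      field_simp
      ring
    exact mul_left_cancel₀ (hfac k) hR

/-- The partitions with exactly `k` parts, as multisets of positive integers. -/
abbrev PartitionsOfLength (k : ℕ) : Type :=
  {m : Multiset ℕ // (∀ x ∈ m, 0 < x) ∧ col m 1 = k}

/-- The partition obtained from `m` by adding a new first column with `a` more boxes than the
first column of `m`. -/
def addCol (a : ℕ) (m : Multiset ℕ) : Multiset ℕ :=
  m.map Nat.succ + Multiset.replicate a 1

/-- The partition obtained from `m` by removing its first column. -/
def removeCol (m : Multiset ℕ) : Multiset ℕ := (m.filter (2 ≤ ·)).map Nat.pred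

lemma addCol_pos (a : ℕ) (m : Multiset ℕ) : ∀ x ∈ addCol a m, 0 < x := by
  intro x hx
  rcases Multiset.mem_add.1 hx with h | h
  · obtain ⟨y, _, rfl⟩ := Multiset.mem_map.1 h
    exact y.succ_pos
  · rw [Multiset.eq_of_mem_replicate h]
    exact one_pos

lemma card_addCol (a : ℕ) (m : Multiset ℕ) : (addCol a m).card = m.card + a := by
  simp [addCol]

lemma sum_addCol (a : ℕ) (m : Multiset ℕ) : (addCol a m).sum = m.sum + (m.card + a) := by
  have : (m.map Nat.succ).sum = m.sum + m.card := by
    induction m using Multiset.induction_on with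
    | empty => simp
    | cons b s ih => simp only [Multiset.map_cons, Multiset.sum_cons, ih, Multiset.card_cons]; omega
  simp [addCol, this]
  ring

lemma removeCol_addCol (a : ℕ) {m : Multiset ℕ} (hm : ∀ x ∈ m, 0 < x) :
    removeCol (addCol a m) = m := by
  have h1 : (m.map Nat.succ).filter (2 ≤ ·) = m.map Nat.succ := by
    refine Multiset.filter_eq_self.2 fun x hx => ?_
    obtain ⟨y, hy, rfl⟩ := Multiset.mem_map.1 hx
    have := hm y hy
    omega
  have h2 : (Multiset.replicate a 1).filter (2 ≤ ·) = 0 := by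
    refine Multiset.filter_eq_nil.2 fun x hx => ?_
    rw [Multiset.eq_of_mem_replicate hx]
    omega
  rw [removeCol, addCol, Multiset.filter_add, h1, h2, add_zero, Multiset.map_map]
  simp

lemma removeCol_pos (m : Multiset ℕ) : ∀ x ∈ removeCol m, 0 < x := by
  intro x hx
  obtain ⟨y, hy, rfl⟩ := Multiset.mem_map.1 hx
  have := (Multiset.mem_filter.1 hy).2
  simp only [Nat.pred_eq_sub_one]
  omega

lemma card_removeCol_le (m : Multiset ℕ) : (removeCol m).card ≤ m.card := by
  rw [removeCol, Multiset.card_map]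
  exact Multiset.card_le_card (Multiset.filter_le _ _)

lemma addCol_removeCol {m : Multiset ℕ} (hm : ∀ x ∈ m, 0 < x) :
    addCol (m.card - (removeCol m).card) (removeCol m) = m := by
  have h1 : (removeCol m).map Nat.succ = m.filter (2 ≤ ·) := by
    rw [removeCol, Multiset.map_map]
    conv_rhs => rw [← Multiset.map_id (m.filter (2 ≤ ·))]
    refine Multiset.map_congr rfl fun x hx => ?_
    have := (Multiset.mem_filter.1 hx).2
    simp only [Function.comp_apply, Nat.pred_eq_sub_one, id]
    omega
  have hc : (m.filter (2 ≤ ·)).card + (m.filter (¬ 2 ≤ ·)).card = m.card := by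
    rw [← Multiset.card_add, Multiset.filter_add_not]
  have h2 : m.filter (¬ 2 ≤ ·) = Multiset.replicate (m.card - (removeCol m).card) 1 := by
    refine Multiset.eq_replicate.2 ⟨?_, fun x hx => ?_⟩
    · rw [removeCol, Multiset.card_map]
      omega
    · have := Multiset.mem_filter.1 hx
      have := hm x this.1
      omega
  rw [addCol, h1, ← h2, Multiset.filter_add_not]

lemma col_addCol (a : ℕ) (m : Multiset ℕ) (i : ℕ) : col (addCol a m) (i + 2) = col m (i + 1) := by
  have h2 : (Multiset.replicate a 1).filter (i + 2 ≤ ·) = 0 := by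
    refine Multiset.filter_eq_nil.2 fun x hx => ?_
    rw [Multiset.eq_of_mem_replicate hx]
    omega
  rw [col, addCol, Multiset.filter_add, h2, add_zero, Multiset.filter_map, Multiset.card_map, col]
  congr 1
  refine Multiset.filter_congr fun x _ => ?_
  simp only [Function.comp_apply]
  omega

lemma count_addCol (a : ℕ) (m : Multiset ℕ) (i : ℕ) :
    (addCol a m).count (i + 2) = m.count (i + 1) := by
  rw [addCol, Multiset.count_add, Multiset.count_replicate, if_neg (by omega), add_zero]
  exact Multiset.count_map_eq_count' _ _ Nat.succ_injective _

lemma count_one_addCol (a : ℕ) {m : Multiset ℕ} (hm : ∀ x ∈ m, 0 < x) :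
    (addCol a m).count 1 = a := by
  rw [addCol, Multiset.count_add, Multiset.count_replicate_self, Multiset.count_eq_zero_of_notMem]
  · simp
  · intro h
    obtain ⟨y, hy, h⟩ := Multiset.mem_map.1 h
    have := hm y hy
    omega

/-- Adding a first column of length `k` to the partitions with at most `k` parts gives every
partition with exactly `k` parts exactly once. -/
noncomputable def addColEquiv (k : ℕ) :
    (Σ j : Fin (k + 1), PartitionsOfLength j) ≃ PartitionsOfLength k :=
  Equiv.ofBijective
    (fun p => ⟨addCol (k - p.1) p.2.1, addCol_pos _ _, by
      have h := p.2.2.2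
      rw [col_one p.2.2.1] at h
      rw [col_one (addCol_pos _ _), card_addCol, h]
      have := p.1.2
      omega⟩) (by
    constructor
    · rintro ⟨j, m, hm, hj⟩ ⟨j', m', hm', hj'⟩ h
      have h := congrArg removeCol (congrArg Subtype.val h)
      simp only [removeCol_addCol _ hm, removeCol_addCol _ hm'] at h
      subst h
      obtain rfl : j = j' := Fin.ext (hj.symm.trans hj')
      rfl
    · rintro ⟨m, hm, hk⟩
      rw [col_one hm] at hk
      have hle := card_removeCol_le m
      refine ⟨⟨⟨(removeCol m).card, by omega⟩, removeCol m, removeCol_pos m,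
        col_one (removeCol_pos m)⟩, Subtype.ext ?_⟩
      subst hk
      exact addCol_removeCol hm)

lemma coe_addColEquiv (k : ℕ) (p : Σ j : Fin (k + 1), PartitionsOfLength j) :
    (addColEquiv k p : Multiset ℕ) = addCol (k - p.1) p.2.1 := rfl

/-- The weight `u^|λ| / ∏ q^{(λ'_i)^2} (1/q)_{m_i(λ)}` of a partition. -/
noncomputable def weight (u q : ℝ) (m : Multiset ℕ) : ℝ :=
  u ^ m.sum / ∏ i ∈ Finset.Icc 1 m.sum, (q ^ ((col m i) ^ 2) * poch 1 q (m.count i))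

lemma prod_col_eq (q : ℝ) {m : Multiset ℕ} {n : ℕ} (hn : m.sum ≤ n) :
    ∏ i ∈ Finset.Icc 1 m.sum, (q ^ ((col m i) ^ 2) * poch 1 q (m.count i)) =
    ∏ i ∈ Finset.range n, (q ^ ((col m (i + 1)) ^ 2) * poch 1 q (m.count (i + 1))) := by
  rw [Finset.range_eq_Ico, Finset.prod_Ico_add'
    (fun i => q ^ ((col m i) ^ 2) * poch 1 q (m.count i)) 0 n 1]
  refine Finset.prod_subset (fun i hi => ?_) fun i hi hi' => ?_
  · simp only [Finset.mem_Icc, Finset.mem_Ico] at *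
    omega
  · have hlt : ∀ x ∈ m, x < i := fun x hx => by
      have := Multiset.single_le_sum (fun y _ => Nat.zero_le y) x hx
      simp only [Finset.mem_Icc, Finset.mem_Ico] at *
      omega
    have h1 : col m i = 0 := by
      rw [col, Multiset.filter_eq_nil.2 fun x hx => by have := hlt x hx; omega, Multiset.card_zero]
    have h2 : m.count i = 0 := Multiset.count_eq_zero_of_notMem fun h => (hlt i h).false
    simp [h1, h2, poch_zero]

lemma weight_addCol (u q : ℝ) (a : ℕ) {m : Multiset ℕ} (hm : ∀ x ∈ m, 0 < x) :
    weight u q (addCol a m) =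
      u ^ (m.card + a) / q ^ ((m.card + a) ^ 2) / poch 1 q a * weight u q m := by
  rw [weight, weight, prod_col_eq q (n := m.sum + (m.card + a) + 1) (by rw [sum_addCol]; omega),
    prod_col_eq q (m := m) (n := m.sum + (m.card + a)) (by omega), Finset.prod_range_succ',
    sum_addCol, pow_add]
  simp only [zero_add, col_addCol, count_addCol, count_one_addCol a hm, col_one (addCol_pos a m),
    card_addCol, div_eq_mul_inv, mul_inv]
  ring

lemma weight_nonneg {u q : ℝ} (hq : 1 < q) (hu : 0 ≤ u) (m : Multiset ℕ) : 0 ≤ weight u q m := by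
  refine div_nonneg (pow_nonneg hu _) (Finset.prod_nonneg fun i _ => ?_)
  have := poch_pos hq le_rfl (m.count i)
  positivity

open scoped ENNReal in
/-- The total weight of the partitions with `k` parts, all of them at most `n`. -/
noncomputable def boundedWeight (u q : ℝ) (n : ℕ∞) (k : ℕ) : ℝ≥0∞ :=
  ∑' m : PartitionsOfLength k,
    {m : Multiset ℕ | ∀ x ∈ m, (x : ℕ∞) ≤ n}.indicator (fun m => ENNReal.ofReal (weight u q m)) m.1

lemma forall_mem_addCol_le {a : ℕ} {m : Multiset ℕ} {n : ℕ∞} :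
    (∀ x ∈ addCol a m, (x : ℕ∞) ≤ n + 1) ↔ ∀ x ∈ m, (x : ℕ∞) ≤ n := by
  constructor
  · intro h x hx
    have := h (x + 1) (Multiset.mem_add.2 (.inl (Multiset.mem_map_of_mem _ hx)))
    push_cast at this
    exact (ENat.add_le_add_iff_right (by simp)).1 this
  · intro h x hx
    rcases Multiset.mem_add.1 hx with hx | hx
    · obtain ⟨y, hy, rfl⟩ := Multiset.mem_map.1 hx
      push_cast
      gcongr
      exact h y hy
    · rw [Multiset.eq_of_mem_replicate hx]
      simp

lemma boundedWeight_add_one {u q : ℝ} (hq : 1 < q) (hu : 0 ≤ u) (n : ℕ∞) (k : ℕ) :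
    boundedWeight u q (n + 1) k = ∑ j : Fin (k + 1),
      ENNReal.ofReal (u ^ k / q ^ (k ^ 2) / poch 1 q (k - j)) * boundedWeight u q n j := by
  rw [boundedWeight, ← (addColEquiv k).tsum_eq, ENNReal.tsum_sigma', tsum_fintype]
  refine Finset.sum_congr rfl fun j _ => ?_
  rw [boundedWeight, ← ENNReal.tsum_mul_left]
  refine tsum_congr fun m => ?_
  have hcard : m.1.card + (k - j) = k := by
    have h := m.2.2
    rw [col_one m.2.1] at h
    have := j.2
    omega
  have hpos := poch_pos hq le_rfl (k - j)
  rw [coe_addColEquiv]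
  by_cases h : ∀ x ∈ m.1, (x : ℕ∞) ≤ n
  · rw [Set.indicator_of_mem (show _ ∈ {m : Multiset ℕ | ∀ x ∈ m, (x : ℕ∞) ≤ n + 1} from
        forall_mem_addCol_le.2 h), Set.indicator_of_mem (show _ ∈ {m : Multiset ℕ | ∀ x ∈ m, (x : ℕ∞) ≤ n} from h),
      weight_addCol u q _ m.2.1, hcard, ENNReal.ofReal_mul (by positivity)]
  · rw [Set.indicator_of_notMem (s := {m : Multiset ℕ | ∀ x ∈ m, (x : ℕ∞) ≤ n + 1})
        (fun h' => h (forall_mem_addCol_le.1 h')),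
      Set.indicator_of_notMem (s := {m : Multiset ℕ | ∀ x ∈ m, (x : ℕ∞) ≤ n}) h, mul_zero]

/-- The closed form of the total weight of the partitions with `k` parts. -/
noncomputable def totalWeight (u q : ℝ) (k : ℕ) : ℝ :=
  u ^ k / (q ^ (k ^ 2) * poch 1 q k * poch u q k)

lemma totalWeight_pos {u q : ℝ} (hq : 1 < q) (hu0 : 0 < u) (hu1 : u ≤ 1) (k : ℕ) :
    0 < totalWeight u q k := by
  have h1 := poch_pos hq le_rfl k
  have h2 := poch_pos hq hu1 k
  rw [totalWeight]
  positivity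

lemma totalWeight_eq_sum {u q : ℝ} (hq : 1 < q) (hu0 : 0 < u) (hu1 : u ≤ 1) (k : ℕ) :
    totalWeight u q k = ∑ j : Fin (k + 1),
      u ^ k / q ^ (k ^ 2) / poch 1 q (k - j) * totalWeight u q j := by
  rw [Fin.sum_univ_eq_sum_range
    (fun j => u ^ k / q ^ (k ^ 2) / poch 1 q (k - j) * totalWeight u q j)]
  calc totalWeight u q k = u ^ k / q ^ (k ^ 2) * (1 / (poch 1 q k * poch u q k)) := by
        rw [totalWeight, div_mul_div_comm, mul_one, mul_assoc]
    _ = _ := by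
        rw [← sum_pow_div_poch hq k u hu0 hu1, Finset.mul_sum]
        refine Finset.sum_congr rfl fun j _ => ?_
        rw [totalWeight]
        simp only [div_eq_mul_inv, mul_inv]
        ring

lemma eq_zero_of_col_one {m : Multiset ℕ} (hm : ∀ x ∈ m, 0 < x) (h : col m 1 = 0) : m = 0 :=
  Multiset.card_eq_zero.1 ((col_one hm).symm.trans h)

lemma boundedWeight_length_zero (u q : ℝ) (n : ℕ∞) : boundedWeight u q n 0 = 1 := by
  rw [boundedWeight, tsum_eq_single ⟨0, by simp [col]⟩]
  · simp [weight]
  · rintro ⟨m, hm, h⟩ hne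
    exact absurd (Subtype.ext (eq_zero_of_col_one hm h)) hne

lemma boundedWeight_le {u q : ℝ} (hq : 1 < q) (hu0 : 0 < u) (hu1 : u ≤ 1) (n : ℕ) :
    ∀ k, boundedWeight u q n k ≤ ENNReal.ofReal (totalWeight u q k) := by
  induction n with
  | zero =>
    rintro (_ | k)
    · rw [boundedWeight_length_zero]
      simp [totalWeight, poch_zero]
    · refine le_of_eq_of_le (ENNReal.tsum_eq_zero.2 ?_) zero_le
      rintro ⟨m, hm, hk⟩
      refine Set.indicator_of_notMem (fun h => ?_) _
      rw [col_one hm] at hk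
      obtain ⟨x, hx⟩ := Multiset.card_pos_iff_exists_mem.1 (by omega : 0 < m.card)
      have h1 := h x hx
      have h2 := hm x hx
      norm_cast at h1
      omega
  | succ n ih =>
    intro k
    push_cast
    rw [boundedWeight_add_one hq hu0.le, totalWeight_eq_sum hq hu0 hu1]
    have hc : ∀ j : Fin (k + 1), 0 ≤ u ^ k / q ^ (k ^ 2) / poch 1 q (k - j) := fun j => by
      have := poch_pos hq le_rfl (k - j)
      positivity
    rw [ENNReal.ofReal_sum_of_nonneg
      fun j _ => mul_nonneg (hc j) (totalWeight_pos hq hu0 hu1 j).le]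
    refine Finset.sum_le_sum fun j _ => ?_
    rw [ENNReal.ofReal_mul (hc j)]
    gcongr
    exact ih j

lemma boundedWeight_top_le {u q : ℝ} (hq : 1 < q) (hu0 : 0 < u) (hu1 : u ≤ 1) (k : ℕ) :
    boundedWeight u q ⊤ k ≤ ENNReal.ofReal (totalWeight u q k) := by
  rw [boundedWeight, ENNReal.tsum_eq_iSup_sum]
  refine iSup_le fun s => ?_
  refine le_trans ?_ (boundedWeight_le hq hu0 hu1 (∑ m ∈ s, m.1.sum) k)
  refine le_trans (Finset.sum_le_sum fun m hm => ?_) (ENNReal.sum_le_tsum s)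
  rw [Set.indicator_of_mem (by simp), Set.indicator_of_mem]
  intro x hx
  have h1 := Multiset.single_le_sum (fun y _ => Nat.zero_le y) x hx
  have h2 := Finset.single_le_sum (f := fun m : PartitionsOfLength k => m.1.sum)
    (fun _ _ => Nat.zero_le _) hm
  exact_mod_cast h1.trans h2

lemma toReal_boundedWeight_top {u q : ℝ} (hq : 1 < q) (hu0 : 0 < u) (hu1 : u ≤ 1) (k : ℕ) :
    (boundedWeight u q ⊤ k).toReal = totalWeight u q k := by
  induction k using Nat.strong_induction_on with
  | _ k ih =>
  rcases Nat.eq_zero_or_pos k with rfl | hk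
  · rw [boundedWeight_length_zero]
    simp [totalWeight, poch_zero]
  have hfin : ∀ j, boundedWeight u q ⊤ j ≠ ⊤ := fun j =>
    ne_top_of_le_ne_top ENNReal.ofReal_ne_top (boundedWeight_top_le hq hu0 hu1 j)
  have hc : ∀ j, 0 ≤ u ^ k / q ^ (k ^ 2) / poch 1 q (k - j) := fun j => by
    have := poch_pos hq le_rfl (k - j)
    positivity
  have h1 := congrArg ENNReal.toReal (boundedWeight_add_one hq hu0.le ⊤ k)
  rw [top_add, ENNReal.toReal_sum (s := Finset.univ)
    (fun (j : Fin (k + 1)) _ => ENNReal.mul_ne_top ENNReal.ofReal_ne_top (hfin j))] at h1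
  simp only [ENNReal.toReal_mul, ENNReal.toReal_ofReal (hc _)] at h1
  have h2 := totalWeight_eq_sum hq hu0 hu1 k
  rw [Fin.sum_univ_castSucc] at h1 h2
  simp only [Fin.val_castSucc, Fin.val_last, Nat.sub_self, poch_zero, div_one] at h1 h2
  rw [Finset.sum_congr rfl fun j _ => by rw [ih j j.2]] at h1
  have hlt : u ^ k / q ^ (k ^ 2) < 1 := by
    have : 1 < q ^ (k ^ 2) := one_lt_pow₀ hq (by positivity)
    rw [div_lt_one (by linarith)]
    exact (pow_le_one₀ hu0.le hu1).trans_lt this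
  have h3 : (1 - u ^ k / q ^ (k ^ 2)) * (boundedWeight u q ⊤ k).toReal =
      (1 - u ^ k / q ^ (k ^ 2)) * totalWeight u q k := by
    linear_combination h1 - h2
  exact mul_left_cancel₀ (sub_pos.2 hlt).ne' h3

lemma hasSum_weight {u q : ℝ} (hq : 1 < q) (hu0 : 0 < u) (hu1 : u ≤ 1) (k : ℕ) :
    HasSum (fun m : PartitionsOfLength k => weight u q m.1) (totalWeight u q k) := by
  have hfin := ne_top_of_le_ne_top ENNReal.ofReal_ne_top (boundedWeight_top_le hq hu0 hu1 k)
  have htop := toReal_boundedWeight_top hq hu0 hu1 k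
  simp only [boundedWeight, le_top, implies_true, Set.ofPred_true, Set.indicator_univ] at hfin htop
  have h := ENNReal.hasSum_toReal hfin
  rw [← ENNReal.tsum_toReal_eq fun _ => ENNReal.ofReal_ne_top, htop] at h
  simpa only [ENNReal.toReal_ofReal (weight_nonneg hq hu0.le _)] using h

lemma multipliable_one_sub_div_pow {q : ℝ} (hq : 1 < q) (u : ℝ) (k : ℕ) :
    Multipliable fun r : ℕ => 1 - u / q ^ (r + k + 1) := by
  have hs : Summable fun r : ℕ => -(u / q ^ (k + 1)) * q⁻¹ ^ r :=
    (summable_geometric_of_lt_one (by positivity) (inv_lt_one_of_one_lt₀ hq)).mul_left _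
  convert Real.multipliable_one_add_of_summable hs using 2 with r
  rw [add_assoc, pow_add, inv_pow]
  field_simp
  ring

lemma mul_affOrder {q : ℝ} (hq : 1 < q) {k : ℕ} (hk : 1 ≤ k) :
    (q ^ k - 1) * affOrder q k = q ^ (k ^ 2) * poch 1 q k := by
  have hq0 : q ≠ 0 := by positivity
  have h : ∀ n, ∏ i ∈ Finset.range n, (q ^ n - q ^ i) = q ^ (n ^ 2) * poch 1 q n := by
    intro n
    have hc : q ^ (n ^ 2) = ∏ _j ∈ Finset.range n, q ^ n := by
      rw [Finset.prod_const, Finset.card_range, sq, pow_mul]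
    rw [poch_eq_prod_range, ← Finset.prod_range_reflect, hc, ← Finset.prod_mul_distrib]
    refine Finset.prod_congr rfl fun j hj => ?_
    have hj' := Finset.mem_range.1 hj
    have e : q ^ n = q ^ (n - 1 - j) * q ^ (j + 1) := by rw [← pow_add]; congr 1; omega
    rw [e]
    field_simp
  obtain ⟨n, rfl⟩ := Nat.exists_eq_add_of_le' hk
  rw [← h, Finset.prod_range_succ', affOrder, Nat.add_sub_cancel, pow_zero]
  have hc : q ^ n = ∏ _i ∈ Finset.range n, q := by rw [Finset.prod_const, Finset.card_range]
  rw [hc, ← Finset.prod_mul_distrib, mul_comm]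
  congr 1
  refine Finset.prod_congr rfl fun i _ => ?_
  rw [← hc]
  ring

/-- The `N_{u,q}`-probability that a partition has exactly `k` parts is
`u^{k-1} / |A(k-1,q)| ⬝ ∏_{r=k+1}^∞ (1 - u/q^r)`. -/
theorem Nmeas_number_of_parts (q u : ℝ) (hq : 1 < q) (hu0 : 0 < u) (hu1 : u < 1)
    (k : ℕ) (hk : 1 ≤ k) :
    HasSum (fun P : {m : Multiset ℕ // (∀ x ∈ m, 0 < x) ∧ col m 1 = k} => Nmeas u q P.1)
      (u ^ (k - 1) / affOrder q k * ∏' r : ℕ, (1 - u / q ^ (r + k + 1))) := by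
  have hsum := (hasSum_weight hq hu0 hu1.le k).mul_left
    ((∏' r : ℕ, (1 - u / q ^ (r + 1))) * (q ^ k - 1) / u)
  have hfun : ∀ P : PartitionsOfLength k, Nmeas u q P.1 =
      (∏' r : ℕ, (1 - u / q ^ (r + 1))) * (q ^ k - 1) / u * weight u q P.1 := by
    intro P
    obtain ⟨m, hm, hmk⟩ := P
    have hpos : m.sum ≠ 0 := by
      rw [col_one hm] at hmk
      obtain ⟨x, hx⟩ := Multiset.card_pos_iff_exists_mem.1 (by omega : 0 < m.card)
      have h1 := Multiset.single_le_sum (fun y _ => Nat.zero_le y) x hx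
      have h2 := hm x hx
      omega
    have hpow : u ^ (m.sum - 1) = u ^ m.sum / u := by
      rw [eq_div_iff hu0.ne', pow_sub_one_mul hpos]
    simp only [Nmeas, weight, hmk, hpow]
    ring
  have hprod : ∏' r : ℕ, (1 - u / q ^ (r + 1)) =
      poch u q k * ∏' r : ℕ, (1 - u / q ^ (r + k + 1)) := by
    rw [poch_eq_prod_range]
    exact (Multipliable.prod_mul_tprod_nat_mul' (f := fun r : ℕ => 1 - u / q ^ (r + 1))
      (multipliable_one_sub_div_pow hq u k)).symm
  have hqk : q ^ k - 1 ≠ 0 := (sub_pos.2 (one_lt_pow₀ hq (by omega))).ne'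
  have hP := (poch_pos hq le_rfl k).ne'
  have hPu := (poch_pos hq hu1.le k).ne'
  have hqk2 : q ^ (k ^ 2) ≠ 0 := by positivity
  have haff : affOrder q k = q ^ (k ^ 2) * poch 1 q k / (q ^ k - 1) := by
    rw [eq_div_iff hqk, mul_comm, mul_affOrder hq hk]
  have hpow : u ^ (k - 1) = u ^ k / u := by
    rw [eq_div_iff hu0.ne', pow_sub_one_mul (by omega)]
  have hval : u ^ (k - 1) / affOrder q k * ∏' r : ℕ, (1 - u / q ^ (r + k + 1)) =
      (∏' r : ℕ, (1 - u / q ^ (r + 1))) * (q ^ k - 1) / u * totalWeight u q k := by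
    rw [hprod, haff, hpow, totalWeight]
    field_simp
  rw [hval, funext hfun]
  exact hsum
end

section
/- Let q be a prime power and k ≥ 1. As n → ∞, the proportion of elements α of the affine group A(n,q) whose fixed space ker(α − I) ⊆ F_q^{n+1} has dimension k converges to [∏_{r=1}^∞ (1 − 1/q^r)] · q^{−(k^2 − k)} / [(1 − 1/q)^2 (1 − 1/q^2)^2 ⋯ (1 − 1/q^{k−1})^2 · (1 − 1/q^k)]. -/
open Matrix

/-- Membership in the affine group `A(n,q)`: invertible `(n+1) × (n+1)` matrices with
`x_{11} = 1` and `x_{j1} = 0` for `j ≥ 2` (indices starting at `0` in Lean). -/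
def IsAff {F : Type} [Field F] {n : ℕ} (x : GL (Fin (n + 1)) F) : Prop :=
  x.val 0 0 = 1 ∧ ∀ j : Fin (n + 1), j ≠ 0 → x.val j 0 = 0

/-- The dimension of the fixed space `ker (α - I) ⊆ F^{n+1}` of `α`. -/
noncomputable def fixedDim {F : Type} [Field F] {n : ℕ} (x : GL (Fin (n + 1)) F) : ℕ :=
  Module.finrank F (LinearMap.ker (Matrix.toLin' (x.val - 1)))

section Analysis

/-- The unnormalised `q`-factorial `∏_{l=1}^{i} (Q^l - 1)`. -/
noncomputable def qFactorialAux (Q : ℝ) (i : ℕ) : ℝ := ∏ l ∈ Finset.range i, (Q ^ (l + 1) - 1)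

lemma one_le_qFactorialAux {Q : ℝ} (hQ : 2 ≤ Q) (i : ℕ) : 1 ≤ qFactorialAux Q i := by
  refine Finset.prod_induction _ (fun x : ℝ => 1 ≤ x) (fun a b ha hb => one_le_mul_of_one_le_of_one_le ha hb)
    le_rfl fun l _ => ?_
  have : (1 : ℝ) ≤ Q ^ l := one_le_pow₀ (by linarith)
  rw [pow_succ]
  nlinarith

lemma qFactorialAux_succ (Q : ℝ) (i : ℕ) :
    qFactorialAux Q (i + 1) = qFactorialAux Q i * (Q ^ (i + 1) - 1) :=
  Finset.prod_range_succ _ _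

/-- A telescoping form of the finite `q`-binomial theorem. -/
lemma sum_prod_sub_pow_div_qFactorialAux {Q : ℝ} (hQ : 2 ≤ Q) (Y : ℝ) (t : ℕ) :
    ∑ i ∈ Finset.range (t + 1),
        (-1) ^ i * (∏ l ∈ Finset.range i, (Y - Q ^ l)) / qFactorialAux Q i =
      (∏ i ∈ Finset.range t, (Q ^ (i + 1) - Y)) / qFactorialAux Q t := by
  induction t with
  | zero => simp
  | succ t ih =>
    have h1 := one_le_qFactorialAux hQ t
    have h2 := one_le_qFactorialAux hQ (t + 1)
    rw [Finset.sum_range_succ, ih]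
    rw [qFactorialAux_succ] at h2 ⊢
    have h3 : Q ^ (t + 1) - 1 ≠ 0 := by
      rintro h
      rw [h] at h2
      norm_num at h2
    have h4 : (-1) ^ (t + 1) * ∏ l ∈ Finset.range (t + 1), (Y - Q ^ l) =
        (1 - Y) * ∏ i ∈ Finset.range t, (Q ^ (i + 1) - Y) := by
      rw [Finset.prod_range_succ', pow_succ]
      have : ∏ i ∈ Finset.range t, (Q ^ (i + 1) - Y) =
          (-1) ^ t * ∏ i ∈ Finset.range t, (Y - Q ^ (i + 1)) := by
        rw [← Finset.card_range t, ← Finset.prod_const, Finset.card_range,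
          ← Finset.prod_mul_distrib]
        exact Finset.prod_congr rfl fun _ _ => by ring
      rw [this]
      ring
    rw [h4, Finset.prod_range_succ]
    have h5 : qFactorialAux Q t ≠ 0 := by positivity
    field_simp
    ring

lemma sum_prod_sub_pow_eq_ite {q : ℕ} (hq : 2 ≤ q) {k K t : ℕ} (hk : 1 ≤ k) (hK : 1 ≤ K)
    (hKt : K ≤ k + t) :
    ∑ i ∈ Finset.range (t + 1), (-1) ^ i * (1 / (q : ℝ) ^ k) ^ i / qFactorialAux q i *
        ∏ l ∈ Finset.range (k - 1 + i), ((q : ℝ) ^ K - (q : ℝ) ^ (l + 1)) =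
      if K = k then ∏ l ∈ Finset.range (k - 1), ((q : ℝ) ^ k - (q : ℝ) ^ (l + 1)) else 0 := by
  have hQ : (2 : ℝ) ≤ q := by exact_mod_cast hq
  have hQ0 : (q : ℝ) ≠ 0 := by positivity
  have key : ∀ i, (1 / (q : ℝ) ^ k) ^ i *
      ∏ l ∈ Finset.range (k - 1 + i), ((q : ℝ) ^ K - (q : ℝ) ^ (l + 1)) =
      (∏ l ∈ Finset.range (k - 1), ((q : ℝ) ^ K - (q : ℝ) ^ (l + 1))) *
        ∏ l ∈ Finset.range i, ((q : ℝ) ^ K / (q : ℝ) ^ k - (q : ℝ) ^ l) := by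
    intro i
    rw [Finset.prod_range_add, mul_left_comm]
    congr 1
    nth_rw 1 [← Finset.card_range i]
    rw [← Finset.prod_const, ← Finset.prod_mul_distrib]
    refine Finset.prod_congr rfl fun l _ => ?_
    rw [show k - 1 + l + 1 = k + l by omega, pow_add]
    field_simp
  have : ∀ i ∈ Finset.range (t + 1), (-1) ^ i * (1 / (q : ℝ) ^ k) ^ i / qFactorialAux q i *
        ∏ l ∈ Finset.range (k - 1 + i), ((q : ℝ) ^ K - (q : ℝ) ^ (l + 1)) =
      (∏ l ∈ Finset.range (k - 1), ((q : ℝ) ^ K - (q : ℝ) ^ (l + 1))) *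
        ((-1) ^ i * (∏ l ∈ Finset.range i, ((q : ℝ) ^ K / (q : ℝ) ^ k - (q : ℝ) ^ l)) /
          qFactorialAux q i) := by
    intro i _
    linear_combination (-1) ^ i / qFactorialAux q i * key i
  rw [Finset.sum_congr rfl this, ← Finset.mul_sum, sum_prod_sub_pow_div_qFactorialAux hQ]
  split_ifs with h
  · subst h
    have h1 := one_le_qFactorialAux hQ t
    have h5 : qFactorialAux q t ≠ 0 := by positivity
    rw [div_self (by positivity)]
    change _ * (qFactorialAux q t / _) = _
    rw [div_self h5, mul_one]
  · rcases lt_or_gt_of_ne h with h | h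
    · rw [Finset.prod_eq_zero (i := K - 1) (by simp; omega), zero_mul]
      rw [Nat.sub_add_cancel hK, sub_self]
    · rw [Finset.prod_eq_zero (s := Finset.range t) (i := K - k - 1) (by simp; omega), zero_div,
        mul_zero]
      rw [← pow_sub₀ _ hQ0 h.le |>.trans (div_eq_mul_inv _ _).symm,
        show K - k - 1 + 1 = K - k by omega, sub_self]

/-- Euler's series `∑ (-y)^i / ((Q - 1)(Q² - 1)⋯(Q^i - 1))`. -/
noncomputable def eulerSeries (Q y : ℝ) : ℝ := ∑' i : ℕ, (-1) ^ i * y ^ i / qFactorialAux Q i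

lemma norm_eulerSeries_term_le {Q y : ℝ} (hQ : 2 ≤ Q) (hy : 0 ≤ y) (i : ℕ) :
    ‖(-1) ^ i * y ^ i / qFactorialAux Q i‖ ≤ y ^ i := by
  have h1 := one_le_qFactorialAux hQ i
  rw [norm_div, norm_mul, norm_pow, norm_pow, norm_neg, norm_one, one_pow, one_mul,
    Real.norm_of_nonneg hy, Real.norm_of_nonneg (by linarith)]
  exact div_le_self (by positivity) h1

lemma summable_eulerSeries {Q y : ℝ} (hQ : 2 ≤ Q) (hy : 0 ≤ y) (hy1 : y < 1) :
    Summable fun i : ℕ => (-1) ^ i * y ^ i / qFactorialAux Q i :=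
  Summable.of_norm_bounded (summable_geometric_of_lt_one hy hy1) (norm_eulerSeries_term_le hQ hy)

lemma eulerSeries_mul {Q y : ℝ} (hQ : 2 ≤ Q) (hy : 0 ≤ y) (hy1 : Q * y < 1) :
    eulerSeries Q (Q * y) = (1 - y) * eulerSeries Q y := by
  have hy2 : y < 1 := by nlinarith
  have s1 := summable_eulerSeries hQ (by positivity : 0 ≤ Q * y) hy1
  have s2 := summable_eulerSeries hQ hy hy2
  have h : eulerSeries Q (Q * y) - eulerSeries Q y = -y * eulerSeries Q y := by
    unfold eulerSeries
    rw [← s1.tsum_sub s2, (s1.sub s2).tsum_eq_zero_add, ← tsum_mul_left]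
    simp only [pow_zero, sub_self, zero_add]
    refine tsum_congr fun i => ?_
    have h1 := one_le_qFactorialAux hQ i
    have h2 := one_le_qFactorialAux hQ (i + 1)
    rw [qFactorialAux_succ] at h2 ⊢
    have h3 : Q ^ (i + 1) - 1 ≠ 0 := by
      rintro h
      rw [h] at h2
      norm_num at h2
    have h5 : qFactorialAux Q i ≠ 0 := by positivity
    field_simp
    ring
  linarith

lemma tendsto_eulerSeries_zero {Q : ℝ} (hQ : 2 ≤ Q) {y : ℕ → ℝ} (hy : ∀ n, 0 ≤ y n)
    (hy1 : ∀ n, y n ≤ 1 / 2) (hlim : Filter.Tendsto y Filter.atTop (nhds 0)) :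
    Filter.Tendsto (fun n => eulerSeries Q (y n)) Filter.atTop (nhds 1) := by
  have h0 : eulerSeries Q 0 = 1 := by
    unfold eulerSeries
    rw [tsum_eq_single 0 fun i hi => by simp [hi]]
    simp [qFactorialAux]
  rw [← h0]
  refine tendsto_tsum_of_dominated_convergence (bound := fun i => (1 / 2 : ℝ) ^ i)
    (summable_geometric_of_lt_one (by norm_num) (by norm_num)) (fun i => ?_)
    (Filter.Eventually.of_forall fun n i => ?_)
  · exact ((hlim.pow i).const_mul _).div_const _
  · exact (norm_eulerSeries_term_le hQ (hy n) i).trans (pow_le_pow_left₀ (hy n) (hy1 n) i)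

lemma prod_mul_eulerSeries {Q : ℝ} (hQ : 2 ≤ Q) {k : ℕ} (hk : 1 ≤ k) :
    (∏ r ∈ Finset.range k, (1 - 1 / Q ^ (r + 1))) * eulerSeries Q (1 / Q ^ k) =
      ∏' r : ℕ, (1 - 1 / Q ^ (r + 1)) := by
  have hQ0 : Q ≠ 0 := by positivity
  have hstep : ∀ N, (∏ r ∈ Finset.range (N + k), (1 - 1 / Q ^ (r + 1))) *
      eulerSeries Q (1 / Q ^ (N + k)) =
      (∏ r ∈ Finset.range k, (1 - 1 / Q ^ (r + 1))) * eulerSeries Q (1 / Q ^ k) := by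
    intro N
    induction N with
    | zero => simp
    | succ N ih =>
      rw [← ih, show N + 1 + k = N + k + 1 by ring, Finset.prod_range_succ, mul_assoc]
      congr 1
      have hQk : Q * (1 / Q ^ (N + k + 1)) = 1 / Q ^ (N + k) := by
        field_simp
        ring
      rw [← eulerSeries_mul hQ (by positivity), hQk]
      rw [hQk, div_lt_one (by positivity)]
      exact one_lt_pow₀ (by linarith) (by omega)
  have hgeom : Summable fun r : ℕ => ‖-(1 / Q ^ (r + 1))‖ := by
    have : Summable fun r : ℕ => (1 / Q) ^ r :=
      summable_geometric_of_lt_one (by positivity) (by rw [div_lt_one] <;> linarith)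
    refine ((summable_nat_add_iff 1).2 this).congr fun r => ?_
    rw [norm_neg, Real.norm_of_nonneg (by positivity), _root_.one_div_pow]
  have hmul : Multipliable fun r : ℕ => 1 - 1 / Q ^ (r + 1) := by
    simpa only [sub_eq_add_neg] using multipliable_one_add_of_summable hgeom
  have h1 := (Filter.tendsto_add_atTop_iff_nat k).2 hmul.tendsto_prod_tprod_nat
  have hpow : Filter.Tendsto (fun N : ℕ => 1 / Q ^ (N + k)) Filter.atTop (nhds 0) := by
    have := tendsto_pow_atTop_nhds_zero_of_lt_one (r := 1 / Q) (by positivity)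
      (by rw [div_lt_one] <;> linarith)
    simpa only [_root_.one_div_pow] using (Filter.tendsto_add_atTop_iff_nat k).2 this
  have h2 := tendsto_eulerSeries_zero hQ (y := fun N : ℕ => 1 / Q ^ (N + k))
    (fun N => by positivity) (fun N => ?_) hpow
  · have h3 := h1.mul h2
    simp only [hstep, mul_one] at h3
    exact tendsto_nhds_unique tendsto_const_nhds h3
  · apply one_div_le_one_div_of_le (by norm_num)
    exact hQ.trans (le_self_pow₀ (by linarith) (by omega))

lemma prod_pow_sub_pow {Q : ℝ} (hQ : 2 ≤ Q) (k : ℕ) :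
    ∏ l ∈ Finset.range (k - 1), (Q ^ k - Q ^ (l + 1)) =
      Q ^ (k ^ 2 - k) * ∏ r ∈ Finset.range (k - 1), (1 - 1 / Q ^ (r + 1)) := by
  have hQ0 : Q ≠ 0 := by positivity
  rw [← Finset.prod_range_reflect (fun r => 1 - 1 / Q ^ (r + 1)),
    show k ^ 2 - k = k * (k - 1) by rw [Nat.mul_sub, sq, mul_one], pow_mul]
  nth_rw 2 [← Finset.card_range (k - 1)]
  rw [← Finset.prod_const, ← Finset.prod_mul_distrib]
  refine Finset.prod_congr rfl fun l hl => ?_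
  have hl := Finset.mem_range.1 hl
  rw [show Q ^ k = Q ^ (l + 1) * Q ^ (k - 1 - 1 - l + 1) by rw [← pow_add]; congr 1; omega]
  field_simp

end Analysis

section Counting

variable {K V : Type*} [Field K] [AddCommGroup V] [Module K V]

/-- Linearly independent families in `W` with prescribed last vector, built one vector at a time. -/
def linearIndependentLastEquiv (W : Submodule K V) (u : V) (j : ℕ) :
    {s : Fin (j + 2) → V // (LinearIndependent K s ∧ s (Fin.last _) = u) ∧ ∀ i, s i ∈ W} ≃
      Σ s : {s : Fin (j + 1) → V //
          (LinearIndependent K s ∧ s (Fin.last _) = u) ∧ ∀ i, s i ∈ W},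
        ((W : Set V) \ (Submodule.span K (Set.range s.val) : Set V) : Set V) where
  toFun s := ⟨⟨Fin.tail s.val, ⟨(linearIndependent_finSucc.mp s.2.1.1).1, s.2.1.2⟩,
      fun i => s.2.2 i.succ⟩,
    ⟨s.val 0, s.2.2 0, (linearIndependent_finSucc.mp s.2.1.1).2⟩⟩
  invFun s := ⟨Fin.cons s.2.val s.1.val,
    ⟨linearIndependent_finCons.mpr ⟨s.1.2.1.1, s.2.2.2⟩, s.1.2.1.2⟩,
    Fin.cases s.2.2.1 s.1.2.2⟩
  left_inv _ := by simp only [Fin.cons_self_tail, Subtype.coe_eta]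
  right_inv := fun ⟨_, _⟩ => rfl

lemma card_linearIndependent_last [Fintype K] [Finite V] (W : Submodule K V) {u : V} (hu : u ∈ W) (hu0 : u ≠ 0) (j : ℕ) :
    (Nat.card {s : Fin (j + 1) → V //
        (LinearIndependent K s ∧ s (Fin.last _) = u) ∧ ∀ i, s i ∈ W} : ℝ) =
      ∏ l ∈ Finset.range j,
        ((Fintype.card K : ℝ) ^ Module.finrank K W - (Fintype.card K : ℝ) ^ (l + 1)) := by
  induction j with
  | zero =>
    rw [Finset.prod_range_zero, Nat.cast_eq_one, Nat.card_eq_one_iff_unique]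
    refine ⟨⟨fun s t => ?_⟩, ⟨⟨fun _ => u, ⟨?_, rfl⟩, fun _ => hu⟩⟩⟩
    · ext i
      have hi : i = Fin.last 0 := Subsingleton.elim (α := Fin 1) _ _
      rw [hi, s.2.1.2, t.2.1.2]
    · exact LinearIndependent.of_subsingleton (ι := Fin 1) 0 hu0
  | succ j ih =>
    have hc : ∀ s : {s : Fin (j + 1) → V //
          (LinearIndependent K s ∧ s (Fin.last _) = u) ∧ ∀ i, s i ∈ W},
        (Nat.card ((W : Set V) \ (Submodule.span K (Set.range s.val) : Set V) : Set V) : ℝ) =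
          (Fintype.card K : ℝ) ^ Module.finrank K W - (Fintype.card K : ℝ) ^ (j + 1) := by
      intro s
      have hle : Submodule.span K (Set.range s.val) ≤ W :=
        Submodule.span_le.2 (Set.range_subset_iff.2 s.2.2)
      have hW : ∀ U : Submodule K V,
          Set.ncard (U : Set V) = Fintype.card K ^ Module.finrank K U := fun U => by
        rw [← Nat.card_coe_set_eq, ← Nat.card_eq_fintype_card]
        exact Module.natCard_eq_pow_finrank
      have h := Set.ncard_sdiff_add_ncard_of_subset (s := (Submodule.span K (Set.range s.val) : Set V))
        (t := (W : Set V)) hle (Set.toFinite _)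
      rw [hW, hW, finrank_span_eq_card s.2.1.1, Fintype.card_fin] at h
      rw [Nat.card_coe_set_eq]
      exact eq_sub_of_add_eq (by exact_mod_cast h)
    have := Fintype.ofFinite {s : Fin (j + 1) → V //
          (LinearIndependent K s ∧ s (Fin.last _) = u) ∧ ∀ i, s i ∈ W}
    rw [Nat.card_congr (linearIndependentLastEquiv W u j), Nat.card_sigma, Nat.cast_sum,
      Finset.sum_congr rfl fun s _ => hc s, Finset.sum_const, nsmul_eq_mul,
      Finset.prod_range_succ, ← ih, Finset.card_univ, Nat.card_eq_fintype_card]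

end Counting

section Transitivity

variable {K V : Type*} [Field K] [AddCommGroup V] [Module K V]

lemma LinearIndependent.exists_linearEquiv_apply_eq {ι : Type*} [Finite ι] {s t : ι → V}
    (hs : LinearIndependent K s) (ht : LinearIndependent K t) :
    ∃ g : V ≃ₗ[K] V, ∀ i, g (s i) = t i := by
  have : FiniteDimensional K (Submodule.span K (Set.range s)) :=
    FiniteDimensional.span_of_finite K (Set.finite_range s)
  let f := (Module.Basis.span hs).equiv (Module.Basis.span ht) (Equiv.refl ι)
  obtain ⟨g, hg⟩ := Submodule.exists_linearEquiv_restrict_eq f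
  refine ⟨g, fun i => ?_⟩
  have h := hg (Module.Basis.span hs i)
  rw [Module.Basis.equiv_apply] at h
  simpa [Module.Basis.span_apply] using h.symm

/-- The stabiliser of `u` acting on the linearly independent families with last vector `u`. -/
def linearIndependentLast (K : Type*) {V : Type*} [Field K] [AddCommGroup V] [Module K V] (u : V)
    (j : ℕ) : SubMulAction (MulAction.stabilizer (V ≃ₗ[K] V) u) (Fin (j + 1) → V) where
  carrier := {s | LinearIndependent K s ∧ s (Fin.last _) = u}
  smul_mem' g s hs := by
    refine ⟨hs.1.map' g.1.toLinearMap (LinearEquiv.ker _), ?_⟩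
    change g.1 (s (Fin.last j)) = u
    rw [hs.2]
    exact g.2

instance (u : V) (j : ℕ) :
    MulAction.IsPretransitive (MulAction.stabilizer (V ≃ₗ[K] V) u)
      (linearIndependentLast K u j) where
  exists_smul_eq s t := by
    obtain ⟨g, hg⟩ := s.2.1.exists_linearEquiv_apply_eq t.2.1
    refine ⟨⟨g, ?_⟩, Subtype.ext (funext hg)⟩
    have := hg (Fin.last j)
    rwa [s.2.2, t.2.2] at this

end Transitivity

section Burnside

variable {K V : Type*} [Field K] [Fintype K] [AddCommGroup V] [Module K V] [Finite V]

lemma sum_stabilizer_prod_pow_sub_pow {u : V} (hu0 : u ≠ 0)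
    [Fintype (MulAction.stabilizer (V ≃ₗ[K] V) u)] {j : ℕ} (hj : j < Module.finrank K V) :
    ∑ g : MulAction.stabilizer (V ≃ₗ[K] V) u, ∏ l ∈ Finset.range j,
        ((Fintype.card K : ℝ) ^ Module.finrank K (LinearMap.ker (g.1.toLinearMap - LinearMap.id)) -
          (Fintype.card K : ℝ) ^ (l + 1)) =
      Fintype.card (MulAction.stabilizer (V ≃ₗ[K] V) u) := by
  classical
  have hfix : ∀ g : MulAction.stabilizer (V ≃ₗ[K] V) u, (∏ l ∈ Finset.range j,
        ((Fintype.card K : ℝ) ^ Module.finrank K (LinearMap.ker (g.1.toLinearMap - LinearMap.id)) -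
          (Fintype.card K : ℝ) ^ (l + 1))) =
      Nat.card (MulAction.fixedBy (linearIndependentLast K u j) g) := by
    intro g
    rw [← card_linearIndependent_last _ (u := u) _ hu0]
    · congr 1
      refine Nat.card_congr ((Equiv.subtypeSubtypeEquivSubtypeInter _ _).symm.trans
        (Equiv.subtypeEquivRight fun s => ?_))
      simp only [LinearMap.mem_ker, LinearMap.sub_apply, sub_eq_zero]
      exact ⟨fun h => Subtype.ext (funext h), fun h i => congrFun (congrArg Subtype.val h) i⟩
    · rw [LinearMap.mem_ker, LinearMap.sub_apply, sub_eq_zero]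
      exact g.2
  have hne : Nonempty (linearIndependentLast K u j) := by
    have h := card_linearIndependent_last (K := K) (⊤ : Submodule K V) trivial hu0 j
    have hpos : (0 : ℝ) < ∏ l ∈ Finset.range j,
        ((Fintype.card K : ℝ) ^ Module.finrank K (⊤ : Submodule K V) -
          (Fintype.card K : ℝ) ^ (l + 1)) := by
      refine Finset.prod_pos fun l hl => sub_pos.2 (pow_lt_pow_right₀ ?_ ?_)
      · exact_mod_cast Fintype.one_lt_card
      · rw [finrank_top]
        have := Finset.mem_range.1 hl
        omega
    rw [← h, Nat.cast_pos] at hpos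
    obtain ⟨⟨s, hs⟩⟩ := (Nat.card_pos_iff.1 hpos).1
    exact ⟨⟨s, hs.1⟩⟩
  have := Fintype.ofFinite (MulAction.orbitRel.Quotient (MulAction.stabilizer (V ≃ₗ[K] V) u)
    (linearIndependentLast K u j))
  have := fun g : MulAction.stabilizer (V ≃ₗ[K] V) u =>
    Fintype.ofFinite (MulAction.fixedBy (linearIndependentLast K u j) g)
  have hb := MulAction.sum_card_fixedBy_eq_card_orbits_mul_card_group
    (MulAction.stabilizer (V ≃ₗ[K] V) u) (linearIndependentLast K u j)
  have hone : Fintype.card (MulAction.orbitRel.Quotient (MulAction.stabilizer (V ≃ₗ[K] V) u)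
    (linearIndependentLast K u j)) = 1 := by
    have hsub := (MulAction.pretransitive_iff_subsingleton_quotient
      (MulAction.stabilizer (V ≃ₗ[K] V) u)
      (linearIndependentLast K u j)).1 inferInstance
    have := (nonempty_quotient_iff
      (MulAction.orbitRel (MulAction.stabilizer (V ≃ₗ[K] V) u) (linearIndependentLast K u j))).2 hne
    rw [← Nat.card_eq_fintype_card, Nat.card_eq_one_iff_unique]
    exact ⟨hsub, this⟩
  rw [hone, one_mul] at hb
  simp only [hfix, Nat.card_eq_fintype_card]
  exact_mod_cast hb

end Burnside

section Affine

variable {F : Type} [Field F] {n : ℕ}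

/-- The affine group is the stabiliser of the first standard basis vector. -/
noncomputable def affEquivStabilizer :
    {x : GL (Fin (n + 1)) F // IsAff x} ≃
      MulAction.stabilizer ((Fin (n + 1) → F) ≃ₗ[F] (Fin (n + 1) → F))
        (Pi.single 0 1 : Fin (n + 1) → F) :=
  Equiv.subtypeEquiv (Matrix.GeneralLinearGroup.toLin.trans
    (LinearMap.GeneralLinearGroup.generalLinearEquiv F (Fin (n + 1) → F))).toEquiv fun x => by
    change _ ↔ x.val *ᵥ Pi.single 0 1 = Pi.single 0 1
    rw [Matrix.mulVec_single_one, funext_iff]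
    constructor
    · intro h i
      by_cases hi : i = 0
      · subst hi
        simpa using h.1
      · simpa [hi] using h.2 i hi
    · intro h
      exact ⟨by simpa using h 0, fun i hi => by simpa [hi] using h i⟩

lemma affEquivStabilizer_sub_id (x : {x : GL (Fin (n + 1)) F // IsAff x}) :
    (affEquivStabilizer x).1.toLinearMap - LinearMap.id = Matrix.toLin' (x.1.val - 1) := by
  rw [map_sub, Matrix.toLin'_one]
  rfl

lemma fixedDim_pos {x : GL (Fin (n + 1)) F} (hx : IsAff x) : 1 ≤ fixedDim x := by
  refine Submodule.one_le_finrank_iff.2 ((Submodule.ne_bot_iff _).2 ⟨Pi.single 0 1, ?_, by simp⟩)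
  rw [← affEquivStabilizer_sub_id ⟨x, hx⟩, LinearMap.mem_ker, LinearMap.sub_apply, sub_eq_zero]
  exact (affEquivStabilizer ⟨x, hx⟩).2

lemma fixedDim_le (x : GL (Fin (n + 1)) F) : fixedDim x ≤ n + 1 :=
  (Submodule.finrank_le _).trans (by simp)

lemma sum_aff_prod_pow_sub_pow [Fintype F] [Fintype {x : GL (Fin (n + 1)) F // IsAff x}] {j : ℕ}
    (hj : j ≤ n) :
    ∑ x : {x : GL (Fin (n + 1)) F // IsAff x}, ∏ l ∈ Finset.range j,
        ((Fintype.card F : ℝ) ^ fixedDim x.1 - (Fintype.card F : ℝ) ^ (l + 1)) =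
      Fintype.card {x : GL (Fin (n + 1)) F // IsAff x} := by
  have := Fintype.ofEquiv _ (affEquivStabilizer (F := F) (n := n))
  rw [Fintype.card_congr (affEquivStabilizer (F := F) (n := n)),
    ← sum_stabilizer_prod_pow_sub_pow (K := F) (j := j) (by simp)
      (by simpa using Nat.lt_succ_of_le hj)]
  refine Fintype.sum_equiv affEquivStabilizer _ _ fun x => ?_
  rw [affEquivStabilizer_sub_id]
  rfl

lemma card_aff_fixedDim_eq [Fintype F] {k : ℕ} (hk : 1 ≤ k) (hkn : k ≤ n + 1) :
    (∏ l ∈ Finset.range (k - 1), ((Fintype.card F : ℝ) ^ k - (Fintype.card F : ℝ) ^ (l + 1))) *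
        Nat.card {x : GL (Fin (n + 1)) F // IsAff x ∧ fixedDim x = k} =
      (∑ i ∈ Finset.range (n + 1 - k + 1),
        (-1) ^ i * (1 / (Fintype.card F : ℝ) ^ k) ^ i / qFactorialAux (Fintype.card F) i) *
        Nat.card {x : GL (Fin (n + 1)) F // IsAff x} := by
  classical
  have := Fintype.ofFinite {x : GL (Fin (n + 1)) F // IsAff x}
  have hcount : Nat.card {x : GL (Fin (n + 1)) F // IsAff x ∧ fixedDim x = k} =
      (Finset.univ.filter
        fun x : {x : GL (Fin (n + 1)) F // IsAff x} => fixedDim x.1 = k).card := by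
    rw [Nat.card_congr (Equiv.subtypeSubtypeEquivSubtypeInter _ _).symm, Nat.card_eq_fintype_card,
      Fintype.card_subtype]
  have hq : 2 ≤ Fintype.card F := Fintype.one_lt_card
  rw [hcount, mul_comm, ← nsmul_eq_mul, ← Finset.sum_const, Finset.sum_filter]
  rw [Finset.sum_congr rfl fun x _ => (sum_prod_sub_pow_eq_ite hq hk (fixedDim_pos x.2)
    (t := n + 1 - k) (by have := fixedDim_le x.1; omega)).symm]
  rw [Finset.sum_comm, Finset.sum_mul]
  refine Finset.sum_congr rfl fun i hi => ?_
  have hi := Finset.mem_range.1 hi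
  rw [← Finset.mul_sum, sum_aff_prod_pow_sub_pow (by omega), Nat.card_eq_fintype_card]

end Affine

/-- As `n → ∞`, the proportion of elements of `A(n,q)` with a `k`-dimensional fixed space
converges to `[∏_{r=1}^∞ (1 - 1/q^r)] q^{-(k²-k)} / ((1-1/q)² ⋯ (1-1/q^{k-1})² (1-1/q^k))`. -/
theorem affine_fixed_space_proportion_limit (F : Type) [Field F] [Fintype F] (q : ℕ)
    (hq : q = Fintype.card F) (k : ℕ) (hk : 1 ≤ k) :
    Filter.Tendsto
      (fun n : ℕ =>
        (Nat.card {x : GL (Fin (n + 1)) F // IsAff x ∧ fixedDim x = k} : ℝ) /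
          (Nat.card {x : GL (Fin (n + 1)) F // IsAff x} : ℝ))
      Filter.atTop
      (nhds ((∏' r : ℕ, (1 - 1 / (q : ℝ) ^ (r + 1))) * (1 / (q : ℝ) ^ (k ^ 2 - k)) /
        ((∏ r ∈ Finset.Icc 1 (k - 1), (1 - 1 / (q : ℝ) ^ r) ^ 2) *
          (1 - 1 / (q : ℝ) ^ k)))) := by
  subst hq
  set Q : ℝ := (Fintype.card F : ℝ) with hQdef
  have hQ : 2 ≤ Q := by
    have : 2 ≤ Fintype.card F := Fintype.one_lt_card
    rw [hQdef]
    exact_mod_cast this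
  have hfac : ∀ r : ℕ, 0 < 1 - 1 / Q ^ (r + 1) := fun r => by
    rw [sub_pos, div_lt_one (by positivity)]
    exact one_lt_pow₀ (by linarith) (by omega)
  have hP : 0 < ∏ r ∈ Finset.range (k - 1), (1 - 1 / Q ^ (r + 1)) :=
    Finset.prod_pos fun r _ => hfac r
  have hk' : 0 < 1 - 1 / Q ^ k := by
    have := hfac (k - 1)
    rwa [Nat.sub_add_cancel hk] at this
  have hy1 : 1 / Q ^ k < 1 := by linarith
  have hprod := prod_pow_sub_pow hQ k
  have hD : 0 < ∏ l ∈ Finset.range (k - 1), (Q ^ k - Q ^ (l + 1)) := by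
    rw [hprod]
    positivity
  have hIcc : ∏ r ∈ Finset.Icc 1 (k - 1), (1 - 1 / Q ^ r) ^ 2 =
      (∏ r ∈ Finset.range (k - 1), (1 - 1 / Q ^ (r + 1))) ^ 2 := by
    rw [← Finset.prod_pow, Finset.range_eq_Ico, Finset.prod_Ico_add' (fun r => (1 - 1 / Q ^ r) ^ 2)]
    rfl
  have heuler := prod_mul_eulerSeries hQ hk
  obtain ⟨a, rfl⟩ : ∃ a, k = a + 1 := ⟨k - 1, by omega⟩
  rw [Finset.prod_range_succ] at heuler
  rw [Nat.add_sub_cancel] at *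
  have hval : (∏' r : ℕ, (1 - 1 / Q ^ (r + 1))) * (1 / Q ^ ((a + 1) ^ 2 - (a + 1))) /
        ((∏ r ∈ Finset.Icc 1 a, (1 - 1 / Q ^ r) ^ 2) * (1 - 1 / Q ^ (a + 1))) =
      eulerSeries Q (1 / Q ^ (a + 1)) /
        ∏ l ∈ Finset.range a, (Q ^ (a + 1) - Q ^ (l + 1)) := by
    rw [hIcc, hprod, ← heuler]
    have hP' := hP.ne'
    have hk'' := hk'.ne'
    generalize (∏ r ∈ Finset.range a, (1 - 1 / Q ^ (r + 1))) = P at *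
    generalize 1 - 1 / Q ^ (a + 1) = R at *
    field_simp
  rw [hval]
  have hsum := (summable_eulerSeries hQ (by positivity) hy1).hasSum.tendsto_sum_nat
  refine ((hsum.comp ((Filter.tendsto_add_atTop_nat 1).comp
    (Filter.tendsto_sub_atTop_nat a))).div_const _).congr' ?_
  filter_upwards [Filter.eventually_ge_atTop a] with n hn
  have hc := card_aff_fixedDim_eq (F := F) hk (Nat.succ_le_succ hn)
  have hA : 0 < (Nat.card {x : GL (Fin (n + 1)) F // IsAff x} : ℝ) := by
    have : Nonempty {x : GL (Fin (n + 1)) F // IsAff x} :=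
      ⟨⟨1, by simp, fun j hj => by simp [hj]⟩⟩
    exact_mod_cast Nat.card_pos
  rw [Nat.add_sub_cancel, Nat.add_sub_add_right] at hc
  rw [div_eq_div_iff hD.ne' hA.ne', mul_comm (Nat.card _ : ℝ)]
  exact hc.symm
end

section
/- Let q be a prime power and let u be a real number with 0 < u < 1. Then Σ_{n=0}^∞ s_A(n,q) u^n = ∏_{d=1}^∞ (1 + u^d/(q^d − 1))^{N'(d,q)}, where N'(d,q) = N(d,q) for d ≥ 2 and N'(1,q) = N(1,q) − 2 = q − 2, N(d,q) being the number of monic irreducible polynomials of degree d over F_q. -/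
open Matrix

/-- `s_A(n,q)`: the proportion of separable elements (squarefree characteristic polynomial)
of the affine group `A(n,q)`. -/
noncomputable def sA (F : Type) [Field F] [Fintype F] (n : ℕ) : ℝ :=
  (Nat.card {x : GL (Fin (n + 1)) F // IsAff x ∧ Squarefree x.val.charpoly} : ℝ) /
    (Nat.card {x : GL (Fin (n + 1)) F // IsAff x} : ℝ)

/-- `N(d,q)`: the number of monic irreducible polynomials of degree `d` over `F_q`. -/
noncomputable def numIrred (F : Type) [Field F] [Fintype F] (d : ℕ) : ℕ :=
  Nat.card {p : Polynomial F // p.Monic ∧ Irreducible p ∧ p.natDegree = d}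

/-- `N'(d,q) = N(d,q)` for `d ≥ 2` and `N'(1,q) = N(1,q) - 2`. -/
noncomputable def numIrred' (F : Type) [Field F] [Fintype F] (d : ℕ) : ℕ :=
  if d = 1 then numIrred F 1 - 2 else numIrred F d

section

open Polynomial

theorem smul_sum_eq_zero_iff_prod_dvd {R M ι : Type*} [CommRing R] [AddCommGroup M]
    [Module R M] (s : Finset ι) (p : ι → R) (x : ι → M)
    (hp : (s : Set ι).Pairwise fun i j => IsCoprime (p i) (p j))
    (hx : ∀ i ∈ s, ∀ g : R, g • x i = 0 ↔ p i ∣ g) (g : R) :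
    g • ∑ i ∈ s, x i = 0 ↔ ∏ i ∈ s, p i ∣ g := by
  classical
  constructor
  · intro h
    refine Finset.prod_dvd_of_coprime hp fun i hi => ?_
    have hcop : IsCoprime (p i) (∏ j ∈ s.erase i, p j) :=
      IsCoprime.prod_right fun j hj =>
        hp hi (Finset.mem_of_mem_erase hj) (Finset.ne_of_mem_erase hj).symm
    refine hcop.dvd_of_dvd_mul_left ?_
    have hrest : ((∏ j ∈ s.erase i, p j) * g) • ∑ j ∈ s.erase i, x j = 0 := by
      rw [Finset.smul_sum]
      exact Finset.sum_eq_zero fun j hj => (hx j (Finset.mem_of_mem_erase hj) _).2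
        ((Finset.dvd_prod_of_mem p hj).mul_right g)
    rw [← hx i hi, ← add_zero (_ • x i), ← hrest, ← smul_add, Finset.add_sum_erase _ _ hi,
      mul_smul, h, smul_zero, hrest]
  · intro h
    rw [Finset.smul_sum]
    exact Finset.sum_eq_zero fun i hi => (hx i hi g).2 ((Finset.dvd_prod_of_mem p hi).trans h)

theorem irreducible_dvd_minpoly_of_dvd_charpoly {F V : Type*} [Field F] [AddCommGroup V]
    [Module F V] [FiniteDimensional F V] (T : Module.End F V) {p : F[X]} (hp : Irreducible p)
    (h : p ∣ T.charpoly) : p ∣ minpoly F T := by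
  have := Fact.mk hp
  let K := AdjoinRoot p
  have hroot : (T.baseChange K).charpoly.IsRoot (AdjoinRoot.root p) := by
    rw [LinearMap.charpoly_baseChange, IsRoot.def, eval_map_algebraMap,
      AdjoinRoot.aeval_eq, AdjoinRoot.mk_eq_zero]
    exact h
  rw [← Module.End.hasEigenvalue_iff_isRoot_charpoly] at hroot
  have hmin : minpoly K (T.baseChange K) ∣ (minpoly F T).map (algebraMap F K) := by
    apply minpoly.dvd
    rw [aeval_map_algebraMap]
    have := aeval_algHom_apply (Module.End.baseChangeHom F K V) T (minpoly F T)
    rwa [minpoly.aeval, map_zero] at this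
  have hdvd := (Module.End.isRoot_of_hasEigenvalue hroot).dvd hmin
  rwa [IsRoot.def, eval_map_algebraMap, AdjoinRoot.aeval_eq, AdjoinRoot.mk_eq_zero] at hdvd

theorem exists_cyclic_vector {F V ι : Type*} [Field F] [AddCommGroup V] [Module F V]
    [FiniteDimensional F V] (T : Module.End F V) (s : Finset ι) (p : ι → F[X])
    (hirr : ∀ i ∈ s, Irreducible (p i))
    (hp : (s : Set ι).Pairwise fun i j => IsCoprime (p i) (p j))
    (hT : T.charpoly = ∏ i ∈ s, p i) :
    ∃ v : V, ∀ g : F[X], aeval T g v = 0 ↔ ∏ i ∈ s, p i ∣ g := by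
  classical
  have hex : ∀ i ∈ s, ∃ w : Module.AEval' T, (∏ j ∈ s.erase i, p j) • w ≠ 0 := by
    intro i hi
    by_contra! h
    have hmin : minpoly F T ∣ ∏ j ∈ s.erase i, p j := by
      refine minpoly.dvd F T (LinearMap.ext fun v => ?_)
      exact h (Module.AEval'.of T v)
    have hdvd : p i ∣ ∏ j ∈ s.erase i, p j :=
      (irreducible_dvd_minpoly_of_dvd_charpoly T (hirr i hi)
        (hT ▸ Finset.dvd_prod_of_mem p hi)).trans hmin
    have hcop : IsCoprime (p i) (∏ j ∈ s.erase i, p j) :=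
      IsCoprime.prod_right fun j hj =>
        hp hi (Finset.mem_of_mem_erase hj) (Finset.ne_of_mem_erase hj).symm
    exact (hirr i hi).not_isUnit (hcop.isUnit_of_dvd' dvd_rfl hdvd)
  choose! w hw using hex
  refine ⟨(Module.AEval'.of T).symm (∑ i ∈ s, (∏ j ∈ s.erase i, p j) • w i), fun g => ?_⟩
  rw [← smul_sum_eq_zero_iff_prod_dvd s p (fun i => (∏ j ∈ s.erase i, p j) • w i) hp]
  · exact Iff.rfl
  · intro i hi g
    have hkill : p i • (∏ j ∈ s.erase i, p j) • w i = 0 := by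
      rw [smul_smul, Finset.mul_prod_erase s p hi, ← hT]
      change aeval T T.charpoly (w i : V) = 0
      rw [LinearMap.aeval_self_charpoly]; rfl
    constructor
    · intro hg
      by_contra hndvd
      obtain ⟨a, b, hab⟩ := ((hirr i hi).coprime_iff_not_dvd).2 hndvd
      apply hw i hi
      rw [← one_smul F[X] ((∏ j ∈ s.erase i, p j) • w i), ← hab, add_smul, mul_smul, hkill,
        mul_smul, hg, smul_zero, smul_zero, add_zero]
    · rintro ⟨c, rfl⟩
      rw [mul_comm, mul_smul, hkill, smul_zero]

/-- An endomorphism with squarefree characteristic polynomial is conjugate to multiplication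
by the root in `AdjoinRoot`. -/
theorem exists_linearEquiv_adjoinRoot {F V ι : Type*} [Field F] [AddCommGroup V] [Module F V]
    [FiniteDimensional F V] (T : Module.End F V) (s : Finset ι) (p : ι → F[X])
    (hirr : ∀ i ∈ s, Irreducible (p i))
    (hp : (s : Set ι).Pairwise fun i j => IsCoprime (p i) (p j))
    (hT : T.charpoly = ∏ i ∈ s, p i) :
    ∃ e : AdjoinRoot (∏ i ∈ s, p i) ≃ₗ[F] V,
      ∀ a, e (AdjoinRoot.root _ * a) = T (e a) := by
  obtain ⟨v, hv⟩ := exists_cyclic_vector T s p hirr hp hT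
  set f := ∏ i ∈ s, p i
  have hf0 : f ≠ 0 := hT ▸ (T.charpoly_monic).ne_zero
  let φ₀ : F[X] →ₗ[F] V := (LinearMap.applyₗ v) ∘ₗ (aeval T).toLinearMap
  have hker : (Ideal.span {f}).restrictScalars F = LinearMap.ker φ₀ := by
    ext g
    simp [φ₀, hv g, Ideal.mem_span_singleton]
  let φ : AdjoinRoot f →ₗ[F] V :=
    Submodule.liftQ ((Ideal.span {f}).restrictScalars F) φ₀ hker.le
  have hφ : ∀ g, φ (AdjoinRoot.mk f g) = aeval T g v := fun g => rfl
  have hinj : Function.Injective φ := by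
    rw [injective_iff_map_eq_zero]
    intro a ha
    obtain ⟨g, rfl⟩ := AdjoinRoot.mk_surjective a
    rw [AdjoinRoot.mk_eq_zero, ← hv, ← hφ, ha]
  have : FiniteDimensional F (AdjoinRoot f) := (AdjoinRoot.powerBasis hf0).finite
  have hdim : Module.finrank F (AdjoinRoot f) = Module.finrank F V := by
    rw [← T.charpoly_natDegree, hT]
    exact finrank_quotient_span_eq_natDegree
  refine ⟨LinearEquiv.ofInjectiveOfFinrankEq φ hinj hdim, fun a => ?_⟩
  obtain ⟨g, rfl⟩ := AdjoinRoot.mk_surjective a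
  change φ _ = T (φ _)
  rw [AdjoinRoot.root, ← map_mul, hφ, hφ, map_mul, aeval_X, Module.End.mul_apply]

theorem charpoly_mulLeft_root {F : Type*} [Field F] {f : F[X]}
    [FiniteDimensional F (AdjoinRoot f)] (hf : f.Monic) :
    (LinearMap.mulLeft F (AdjoinRoot.root f)).charpoly = f := by
  have h := charpoly_leftMulMatrix (AdjoinRoot.powerBasis hf.ne_zero)
  rw [AdjoinRoot.minpoly_powerBasis_gen_of_monic hf] at h
  rw [← LinearMap.charpoly_toMatrix _ (AdjoinRoot.powerBasis hf.ne_zero).basis]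
  exact h

/-- The number of endomorphisms of `AdjoinRoot f` with characteristic polynomial `f`, for a
squarefree `f`. -/
theorem card_end_charpoly_eq_mul_card_units {F ι : Type*} [Field F]
    (s : Finset ι) (p : ι → F[X]) [FiniteDimensional F (AdjoinRoot (∏ i ∈ s, p i))]
    (hirr : ∀ i ∈ s, Irreducible (p i))
    (hmonic : ∀ i ∈ s, (p i).Monic)
    (hp : (s : Set ι).Pairwise fun i j => IsCoprime (p i) (p j)) :
    Nat.card {T : Module.End F (AdjoinRoot (∏ i ∈ s, p i)) // T.charpoly = ∏ i ∈ s, p i} *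
      Nat.card (AdjoinRoot (∏ i ∈ s, p i))ˣ =
    Nat.card (Module.End F (AdjoinRoot (∏ i ∈ s, p i)))ˣ := by
  have hmon : (∏ i ∈ s, p i).Monic := monic_prod_of_monic _ _ hmonic
  set f := ∏ i ∈ s, p i with hf
  let A := AdjoinRoot f
  let C : Module.End F A := LinearMap.mulLeft F (AdjoinRoot.root f)
  have horbit : MulAction.orbit (ConjAct (Module.End F A)ˣ) C = {T | T.charpoly = f} := by
    ext T
    constructor
    · rintro ⟨g, rfl⟩
      change LinearMap.charpoly (g • C) = f
      let e : A ≃ₗ[F] A := LinearMap.GeneralLinearGroup.toLinearEquiv (ConjAct.ofConjAct g)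
      have : g • C = e.conj C := rfl
      rw [this, LinearEquiv.charpoly_conj, charpoly_mulLeft_root hmon]
    · intro hT
      obtain ⟨e, he⟩ := exists_linearEquiv_adjoinRoot T s p hirr hp hT
      refine ⟨ConjAct.toConjAct (LinearMap.GeneralLinearGroup.ofLinearEquiv e), ?_⟩
      refine LinearMap.ext fun a => ?_
      change e (AdjoinRoot.root f * e.symm a) = T a
      rw [he, e.apply_symm_apply]
  let ψ : Aˣ →* ConjAct (Module.End F A)ˣ :=
    (ConjAct.toConjAct.toMonoidHom).comp (Units.map (Algebra.lmul F A : A →* Module.End F A))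
  have hψ : Function.Injective ψ := by
    intro a b hab
    have := congrArg (fun g => ((ConjAct.ofConjAct g : (Module.End F A)ˣ) : Module.End F A) 1) hab
    simpa [ψ, Units.ext_iff] using this
  have hrange : Set.range ψ = MulAction.stabilizer (ConjAct (Module.End F A)ˣ) C := by
    ext g
    rw [SetLike.mem_coe, MulAction.mem_stabilizer_iff, ConjAct.units_smul_def,
      Units.mul_inv_eq_iff_eq_mul]
    constructor
    · rintro ⟨a, rfl⟩
      refine LinearMap.ext fun b => ?_
      change (a : A) * (AdjoinRoot.root f * b) = AdjoinRoot.root f * (a * b)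
      ring
    · intro hg
      let G : Module.End F A := (ConjAct.ofConjAct g : (Module.End F A)ˣ)
      have hroot : ∀ b, G (AdjoinRoot.root f * b) = AdjoinRoot.root f * G b := fun b =>
        LinearMap.congr_fun hg b
      have hpow : ∀ (k : ℕ) b, G (AdjoinRoot.root f ^ k * b) = AdjoinRoot.root f ^ k * G b := by
        intro k
        induction k with
        | zero => simp
        | succ k ih => intro b; rw [pow_succ', mul_assoc, hroot, ih, mul_assoc]
      have hmul : ∀ a b, G (a * b) = a * G b := by
        intro a b
        obtain ⟨r, rfl⟩ := AdjoinRoot.mk_surjective a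
        induction r using Polynomial.induction_on' with
        | add r t hr ht => rw [map_add, add_mul, map_add, hr, ht, add_mul]
        | monomial k c =>
          rw [← C_mul_X_pow_eq_monomial, RingHom.map_mul, RingHom.map_pow, AdjoinRoot.mk_X,
            mul_assoc, AdjoinRoot.mk_C, ← AdjoinRoot.algebraMap_eq, ← Algebra.smul_def, map_smul,
            hpow, mul_assoc, ← Algebra.smul_def]
      have hG : ∀ a, G a = G 1 * a := fun a => by rw [mul_comm, ← hmul, mul_one]
      have hsurj : Function.Surjective G :=
        (LinearMap.GeneralLinearGroup.toLinearEquiv (ConjAct.ofConjAct g)).surjective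
      obtain ⟨b, hb⟩ := hsurj 1
      rw [hG] at hb
      refine ⟨Units.mkOfMulEqOne (G 1) b hb, ?_⟩
      apply ConjAct.ofConjAct.injective
      refine Units.ext (LinearMap.ext fun a => ?_)
      exact (hG a).symm
  have hstab : Nat.card Aˣ = Nat.card (MulAction.stabilizer (ConjAct (Module.End F A)ˣ) C) := by
    rw [Nat.card_congr (Equiv.ofInjective ψ hψ), hrange]; rfl
  have horb : Nat.card {T : Module.End F A // T.charpoly = f} =
      Nat.card (MulAction.orbit (ConjAct (Module.End F A)ˣ) C) := by
    rw [horbit]; rfl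
  rw [hstab, horb, ← Nat.card_prod, Nat.card_congr (MulAction.orbitProdStabilizerEquivGroup _ C)]
  exact Nat.card_congr ConjAct.ofConjAct.toEquiv

theorem card_units_adjoinRoot_irreducible {F : Type*} [Field F] [Finite F] {p : F[X]}
    (hp : Irreducible p) :
    Nat.card (AdjoinRoot p)ˣ = Nat.card F ^ p.natDegree - 1 := by
  have := Fact.mk hp
  have : FiniteDimensional F (AdjoinRoot p) := (AdjoinRoot.powerBasis hp.ne_zero).finite
  have : Finite (AdjoinRoot p) := Module.finite_of_finite F
  rw [Nat.card_units, Module.natCard_eq_pow_finrank (K := F),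
    show Module.finrank F (AdjoinRoot p) = p.natDegree from finrank_quotient_span_eq_natDegree]

theorem card_units_adjoinRoot_prod {F ι : Type*} [Field F] [Finite F]
    (s : Finset ι) (p : ι → F[X]) (hirr : ∀ i ∈ s, Irreducible (p i))
    (hp : (s : Set ι).Pairwise fun i j => IsCoprime (p i) (p j)) :
    Nat.card (AdjoinRoot (∏ i ∈ s, p i))ˣ = ∏ i ∈ s, (Nat.card F ^ (p i).natDegree - 1) := by
  have hcop : ∀ i j : s, i ≠ j → IsCoprime (p i) (p j) := fun i j hij =>
    hp i.2 j.2 (Subtype.coe_injective.ne hij)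
  have hideal : Ideal.span {∏ i ∈ s, p i} = ⨅ i : s, Ideal.span {p i} := by
    rw [Ideal.iInf_span_singleton hcop, Finset.prod_coe_sort s p]
  let e : AdjoinRoot (∏ i ∈ s, p i) ≃+* ∀ i : s, AdjoinRoot (p i) :=
    (Ideal.quotEquivOfEq hideal).trans (Ideal.quotientInfRingEquivPiQuotient _ fun i j hij =>
      (Ideal.isCoprime_span_singleton_iff _ _).2 (hcop i j hij))
  rw [Nat.card_congr ((Units.mapEquiv e.toMulEquiv).trans MulEquiv.piUnits).toEquiv, Nat.card_pi,
    Finset.prod_coe_sort s fun i => Nat.card (AdjoinRoot (p i))ˣ]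
  exact Finset.prod_congr rfl fun i hi => card_units_adjoinRoot_irreducible (hirr i hi)

/-- The number of matrices whose characteristic polynomial is a given squarefree polynomial. -/
theorem card_matrix_charpoly_eq_mul_prod {F ι : Type*} [Field F] [Finite F] {n : ℕ}
    (s : Finset ι) (p : ι → F[X]) (hirr : ∀ i ∈ s, Irreducible (p i))
    (hmonic : ∀ i ∈ s, (p i).Monic)
    (hp : (s : Set ι).Pairwise fun i j => IsCoprime (p i) (p j))
    (hn : ∑ i ∈ s, (p i).natDegree = n) :
    Nat.card {M : Matrix (Fin n) (Fin n) F // M.charpoly = ∏ i ∈ s, p i} *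
      ∏ i ∈ s, (Nat.card F ^ (p i).natDegree - 1) =
      Nat.card (Matrix.GeneralLinearGroup (Fin n) F) := by
  have hmon : (∏ i ∈ s, p i).Monic := monic_prod_of_monic _ _ hmonic
  have : FiniteDimensional F (AdjoinRoot (∏ i ∈ s, p i)) :=
    (AdjoinRoot.powerBasis hmon.ne_zero).finite
  have hdim : Module.finrank F (AdjoinRoot (∏ i ∈ s, p i)) = n := by
    rw [← hn, ← natDegree_prod_of_monic _ _ hmonic]
    exact finrank_quotient_span_eq_natDegree
  let b := Module.finBasisOfFinrankEq F (AdjoinRoot (∏ i ∈ s, p i)) hdim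
  rw [← card_units_adjoinRoot_prod s p hirr hp]
  have hGL : Nat.card (Matrix.GeneralLinearGroup (Fin n) F) =
      Nat.card (Module.End F (AdjoinRoot (∏ i ∈ s, p i)))ˣ :=
    (Nat.card_congr (Units.mapEquiv (LinearMap.toMatrixAlgEquiv b).toMulEquiv).toEquiv).symm
  rw [hGL, ← card_end_charpoly_eq_mul_card_units s p hirr hmonic hp]
  congr 1
  refine (Nat.card_congr ((LinearMap.toMatrix b b).toEquiv.subtypeEquiv fun T => ?_)).symm
  rw [← LinearMap.charpoly_toMatrix T b]
  rfl

theorem det_of_col_zero {R : Type*} [CommRing R] {n : ℕ}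
    (x : Matrix (Fin (n + 1)) (Fin (n + 1)) R) (h : ∀ j, j ≠ 0 → x j 0 = 0) :
    x.det = x 0 0 * (x.submatrix Fin.succ Fin.succ).det := by
  rw [det_succ_column_zero, Fin.sum_univ_succ, Finset.sum_eq_zero]
  · simp
  · intro i _
    simp [h _ (Fin.succ_ne_zero i)]

theorem charpoly_of_col_zero {R : Type*} [CommRing R] {n : ℕ}
    (x : Matrix (Fin (n + 1)) (Fin (n + 1)) R) (h : ∀ j, j ≠ 0 → x j 0 = 0) :
    x.charpoly = (X - C (x 0 0)) * (x.submatrix Fin.succ Fin.succ).charpoly := by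
  rw [Matrix.charpoly, det_of_col_zero, charmatrix_apply_eq, Matrix.charpoly]
  · congr 2
    ext i j : 2
    by_cases hij : i = j
    · subst hij; simp
    · simp [hij]
  · intro j hj
    rw [charmatrix_apply_ne _ _ _ hj, h j hj, map_zero, neg_zero]

theorem card_isAff_charpoly {F : Type} [Field F] [Finite F] (n : ℕ) (Q : F[X] → Prop) :
    Nat.card {x : GL (Fin (n + 1)) F // IsAff x ∧ Q x.val.charpoly} =
      Nat.card (Fin n → F) *
        Nat.card {y : GL (Fin n) F // Q ((X - C 1) * y.val.charpoly)} := by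
  let lift : (Fin n → F) → Matrix (Fin n) (Fin n) F → Matrix (Fin (n + 1)) (Fin (n + 1)) F :=
    fun v y => Fin.cons (Fin.cons 1 v) fun i => Fin.cons 0 (y i)
  have hlift : ∀ v y, (lift v y).submatrix Fin.succ Fin.succ = y := fun v y => rfl
  have hlift0 : ∀ v y j, j ≠ 0 → lift v y j 0 = 0 := by
    intro v y j hj
    obtain ⟨j, rfl⟩ := Fin.exists_succ_eq.2 hj
    rfl
  have hdet : ∀ v y, (lift v y).det = y.det := fun v y => by
    rw [det_of_col_zero _ (hlift0 v y), hlift, show lift v y 0 0 = 1 from rfl, one_mul]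
  have hcharpoly : ∀ v y, (lift v y).charpoly = (X - C 1) * y.charpoly := fun v y => by
    rw [charpoly_of_col_zero _ (hlift0 v y), hlift, show lift v y 0 0 = 1 from rfl]
  rw [← Nat.card_prod]
  symm
  let Φ : (Fin n → F) × {y : GL (Fin n) F // Q ((X - C 1) * y.val.charpoly)} →
      {x : GL (Fin (n + 1)) F // IsAff x ∧ Q x.val.charpoly} := fun vy =>
    ⟨GeneralLinearGroup.mkOfDetNeZero (lift vy.1 vy.2.1.val) (by
        rw [hdet]; exact vy.2.1.det_ne_zero),
      ⟨rfl, hlift0 _ _⟩, by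
        change Q (lift vy.1 vy.2.1.val).charpoly
        rw [hcharpoly]; exact vy.2.2⟩
  refine Nat.card_congr (Equiv.ofBijective Φ ⟨?_, ?_⟩)
  · rintro ⟨v, y⟩ ⟨w, z⟩ h
    have hmat : lift v y.1.val = lift w z.1.val := congrArg (fun x => x.1.val) h
    refine Prod.ext (funext fun i => congrFun (congrFun hmat 0) i.succ) ?_
    exact Subtype.ext (Units.ext (congrArg (fun m => m.submatrix Fin.succ Fin.succ) hmat))
  · rintro ⟨x, ⟨h0, hx⟩, hQ⟩
    let y := x.val.submatrix Fin.succ Fin.succ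
    have heq : lift (fun i => x.val 0 i.succ) y = x.val := by
      ext i j
      refine Fin.cases ?_ (fun i => ?_) i <;> refine Fin.cases ?_ (fun j => ?_) j
      · exact h0.symm
      · rfl
      · exact (hx _ (Fin.succ_ne_zero i)).symm
      · rfl
    have hy : y.det ≠ 0 := by
      rw [← hdet (fun i => x.val 0 i.succ) y, heq]; exact x.det_ne_zero
    refine ⟨⟨fun i => x.val 0 i.succ, GeneralLinearGroup.mkOfDetNeZero y hy, ?_⟩, ?_⟩
    · change Q ((X - C 1) * y.charpoly)
      rwa [← hcharpoly (fun i => x.val 0 i.succ) y, heq]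
    · exact Subtype.ext (Units.ext heq)

section
variable (F : Type*) [Field F]

/-- Monic irreducible polynomials other than `X` and `X - 1`. -/
abbrev AffPrime : Type _ :=
  {p : F[X] // p.Monic ∧ Irreducible p ∧ p ≠ X ∧ p ≠ X - C 1}

variable {F}

/-- The degree of the product of a finite set of monic irreducible polynomials. -/
noncomputable def affDegree (S : Finset (AffPrime F)) : ℕ := ∑ p ∈ S, p.1.natDegree

theorem isCoprime_of_monic_irreducible_ne {p q : F[X]} (hp : p.Monic) (hp' : Irreducible p)
    (hq : q.Monic) (hq' : Irreducible q) (h : p ≠ q) : IsCoprime p q :=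
  (hp'.coprime_iff_not_dvd).2 fun hdvd =>
    h (eq_of_monic_of_associated hp hq (hp'.associated_of_dvd hq' hdvd))

theorem pairwise_isCoprime_affPrime (S : Finset (AffPrime F)) :
    (S : Set (AffPrime F)).Pairwise fun p r => IsCoprime p.1 r.1 := fun p _ r _ h =>
  isCoprime_of_monic_irreducible_ne p.2.1 p.2.2.1 r.2.1 r.2.2.1 (Subtype.coe_injective.ne h)

theorem monic_prod_affPrime (S : Finset (AffPrime F)) : (∏ p ∈ S, p.1).Monic :=
  monic_prod_of_monic _ _ fun p _ => p.2.1

theorem natDegree_prod_affPrime (S : Finset (AffPrime F)) :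
    (∏ p ∈ S, p.1).natDegree = affDegree S :=
  natDegree_prod_of_monic _ _ fun p _ => p.2.1

theorem isCoprime_X_prod_affPrime (S : Finset (AffPrime F)) : IsCoprime X (∏ p ∈ S, p.1) :=
  IsCoprime.prod_right fun p _ =>
    isCoprime_of_monic_irreducible_ne monic_X irreducible_X p.2.1 p.2.2.1 p.2.2.2.1.symm

theorem squarefree_X_sub_one_mul_prod_affPrime (S : Finset (AffPrime F)) :
    Squarefree ((X - C 1) * ∏ p ∈ S, p.1) := by
  rw [squarefree_mul_iff]
  refine ⟨IsCoprime.isRelPrime (IsCoprime.prod_right fun p _ =>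
    isCoprime_of_monic_irreducible_ne (monic_X_sub_C 1) (irreducible_X_sub_C 1) p.2.1 p.2.2.1
      p.2.2.2.2.symm), (irreducible_X_sub_C 1).squarefree, ?_⟩
  exact Finset.squarefree_prod_of_pairwise_isCoprime
    (fun p hp r hr h => (pairwise_isCoprime_affPrime S hp hr h).isRelPrime)
    fun p _ => p.2.2.1.squarefree

theorem mem_iff_dvd_prod_affPrime (S : Finset (AffPrime F)) (p : AffPrime F) :
    p ∈ S ↔ p.1 ∣ ∏ r ∈ S, r.1 := by
  refine ⟨fun h => Finset.dvd_prod_of_mem (fun r : AffPrime F => r.1) h, fun h => ?_⟩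
  obtain ⟨r, hr, hdvd⟩ := (p.2.2.1.prime.dvd_finsetProd_iff _).1 h
  have : p = r := Subtype.ext
    (eq_of_monic_of_associated p.2.1 r.2.1 (p.2.2.1.associated_of_dvd r.2.2.1 hdvd))
  rwa [this]

theorem prod_affPrime_injective :
    Function.Injective fun S : Finset (AffPrime F) => ∏ p ∈ S, p.1 := fun S T h =>
  Finset.ext fun p => by
    rw [mem_iff_dvd_prod_affPrime, mem_iff_dvd_prod_affPrime]
    exact iff_of_eq (congrArg (p.1 ∣ ·) h)

theorem exists_prod_affPrime_eq {f : F[X]} (hf : f.Monic) (hX : ¬ X ∣ f)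
    (hsq : Squarefree ((X - C 1) * f)) : ∃ S : Finset (AffPrime F), ∏ p ∈ S, p.1 = f := by
  classical
  rw [squarefree_mul_iff] at hsq
  obtain ⟨hrel, -, hsqf⟩ := hsq
  have hmem : ∀ p ∈ (UniqueFactorizationMonoid.normalizedFactors f).toFinset,
      p.Monic ∧ Irreducible p ∧ p ≠ X ∧ p ≠ X - C 1 := by
    intro p hp
    rw [Multiset.mem_toFinset, Polynomial.mem_normalizedFactors_iff hf.ne_zero] at hp
    obtain ⟨hirr, hmonic, hdvd⟩ := hp
    refine ⟨hmonic, hirr, ?_, ?_⟩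
    · rintro rfl; exact hX hdvd
    · rintro rfl; exact hirr.not_isUnit (hrel dvd_rfl hdvd)
  refine ⟨(UniqueFactorizationMonoid.normalizedFactors f).toFinset.subtype _, ?_⟩
  rw [Finset.prod_subtype_of_mem (fun p => p) hmem]
  change Multiset.prod (Multiset.map (fun p => p) (Multiset.dedup _)) = _
  rw [Multiset.map_id', Multiset.dedup_eq_self.2
    ((UniqueFactorizationMonoid.squarefree_iff_nodup_normalizedFactors hf.ne_zero).1 hsqf),
    UniqueFactorizationMonoid.prod_normalizedFactors_eq hf.ne_zero, hf.normalize_eq_self]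

instance instFiniteAffDegree [Finite F] (n : ℕ) :
    Finite {S : Finset (AffPrime F) // affDegree S = n} := by
  let Φ : {S : Finset (AffPrime F) // affDegree S = n} → degreeLT F (n + 1) := fun S =>
    ⟨∏ p ∈ S.1, p.1, by
      rw [mem_degreeLT, degree_eq_natDegree (monic_prod_affPrime S.1).ne_zero,
        natDegree_prod_affPrime, S.2]
      exact_mod_cast Nat.lt_succ_self n⟩
  have : Finite (degreeLT F (n + 1)) := Finite.of_equiv _ (degreeLTEquiv F (n + 1)).symm.toEquiv
  exact Finite.of_injective Φ fun S T h =>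
    Subtype.ext (prod_affPrime_injective (congrArg Subtype.val h))

theorem X_dvd_charpoly_iff {n : ℕ} (M : Matrix (Fin n) (Fin n) F) :
    X ∣ M.charpoly ↔ M.det = 0 := by
  rw [X_dvd_iff, Matrix.det_eq_sign_charpoly_coeff]
  simp

theorem card_GL_squarefree_eq_sum [Finite F] (n : ℕ)
    [Fintype {S : Finset (AffPrime F) // affDegree S = n}] :
    Nat.card {y : GL (Fin n) F // Squarefree ((X - C 1) * y.val.charpoly)} =
      ∑ S : {S : Finset (AffPrime F) // affDegree S = n},
        Nat.card {M : Matrix (Fin n) (Fin n) F // M.charpoly = ∏ p ∈ S.1, p.1} := by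
  rw [← Nat.card_sigma]
  symm
  let Φ : (Σ S : {S : Finset (AffPrime F) // affDegree S = n},
      {M : Matrix (Fin n) (Fin n) F // M.charpoly = ∏ p ∈ S.1, p.1}) →
      {y : GL (Fin n) F // Squarefree ((X - C 1) * y.val.charpoly)} := fun SM =>
    ⟨GeneralLinearGroup.mkOfDetNeZero SM.2.1 (by
        rw [ne_eq, ← X_dvd_charpoly_iff, SM.2.2]
        exact fun h => irreducible_X.not_isUnit
          ((isCoprime_X_prod_affPrime SM.1.1).isUnit_of_dvd' dvd_rfl h)), by
      change Squarefree ((X - C 1) * SM.2.1.charpoly)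
      rw [SM.2.2]
      exact squarefree_X_sub_one_mul_prod_affPrime SM.1.1⟩
  refine Nat.card_congr (Equiv.ofBijective Φ ⟨?_, ?_⟩)
  · rintro ⟨⟨S, hS⟩, M, hM⟩ ⟨⟨T, hT⟩, N, hN⟩ h
    obtain rfl : M = N := congrArg (fun y => y.1.val) h
    obtain rfl : S = T := prod_affPrime_injective (hM.symm.trans hN)
    rfl
  · rintro ⟨y, hy⟩
    obtain ⟨S, hS⟩ := exists_prod_affPrime_eq y.val.charpoly_monic
      (by rw [X_dvd_charpoly_iff]; exact y.det_ne_zero) hy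
    have hdeg : affDegree S = n := by
      rw [← natDegree_prod_affPrime, hS, Matrix.charpoly_natDegree_eq_dim, Fintype.card_fin]
    exact ⟨⟨⟨S, hdeg⟩, y.val, hS.symm⟩, Subtype.ext (Units.ext rfl)⟩
end

theorem hasSum_sA (F : Type) [Field F] [Fintype F] (n : ℕ) :
    HasSum (fun S : {S : Finset (AffPrime F) // affDegree S = n} =>
      ∏ p ∈ S.1, ((Fintype.card F : ℝ) ^ p.1.natDegree - 1)⁻¹) (sA F n) := by
  cases nonempty_fintype {S : Finset (AffPrime F) // affDegree S = n}
  have hnum := card_isAff_charpoly (F := F) n Squarefree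
  have hden := card_isAff_charpoly (F := F) n fun _ => True
  simp only [and_true, Nat.card_congr (Equiv.subtypeUnivEquiv fun _ => trivial)] at hden
  have hv : (Nat.card (Fin n → F) : ℝ) ≠ 0 := Nat.cast_ne_zero.2 Nat.card_pos.ne'
  have hGL : (Nat.card (GL (Fin n) F) : ℝ) ≠ 0 := Nat.cast_ne_zero.2 Nat.card_pos.ne'
  have hsA : sA F n = ∑ S : {S : Finset (AffPrime F) // affDegree S = n},
      ∏ p ∈ S.1, ((Fintype.card F : ℝ) ^ p.1.natDegree - 1)⁻¹ := by
    rw [sA, hnum, hden, card_GL_squarefree_eq_sum, Nat.cast_mul, Nat.cast_mul,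
      mul_div_mul_left _ _ hv, Nat.cast_sum, Finset.sum_div]
    refine Finset.sum_congr rfl fun S _ => ?_
    have h := card_matrix_charpoly_eq_mul_prod (n := n) S.1 (fun p : AffPrime F => p.1)
      (fun p _ => p.2.2.1) (fun p _ => p.2.1) (pairwise_isCoprime_affPrime S.1) S.2
    have hcast : ((∏ p ∈ S.1, (Nat.card F ^ p.1.natDegree - 1) : ℕ) : ℝ) =
        ∏ p ∈ S.1, ((Fintype.card F : ℝ) ^ p.1.natDegree - 1) := by
      rw [Nat.cast_prod]
      refine Finset.prod_congr rfl fun p _ => ?_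
      rw [Nat.cast_sub (Nat.one_le_pow _ _ Nat.card_pos), Nat.card_eq_fintype_card]
      push_cast
      rfl
    rw [Finset.prod_inv_distrib, ← hcast, ← h, Nat.cast_mul, div_mul_cancel_left₀]
    rw [← h, Nat.cast_mul] at hGL
    exact left_ne_zero_of_mul hGL
  rw [hsA]
  exact hasSum_fintype _

instance instFiniteMonicDegree {F : Type*} [Field F] [Finite F] (n : ℕ) :
    Finite {p : F[X] // p.Monic ∧ p.natDegree = n} :=
  Finite.of_equiv _ ((monicEquivDegreeLT n).trans (degreeLTEquiv F n).toEquiv).symm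

theorem card_monic_natDegree (F : Type*) [Field F] [Finite F] (n : ℕ) :
    Nat.card {p : F[X] // p.Monic ∧ p.natDegree = n} = Nat.card F ^ n := by
  rw [Nat.card_congr ((monicEquivDegreeLT n).trans (degreeLTEquiv F n).toEquiv), Nat.card_fun,
    Nat.card_fin]

instance instFiniteAffPrimeFiber {F : Type*} [Field F] [Finite F] (d : ℕ) :
    Finite {p : AffPrime F // p.1.natDegree - 1 = d} :=
  Finite.of_injective (β := {p : F[X] // p.Monic ∧ p.natDegree = d + 1})
    (fun p => ⟨p.1.1, p.1.2.1, by have := p.1.2.2.1.natDegree_pos; have := p.2; omega⟩)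
    fun p r h => Subtype.ext (Subtype.ext (congrArg (fun r => r.1) h))

theorem card_affPrime_fiber_le (F : Type*) [Field F] [Finite F] (d : ℕ) :
    Nat.card {p : AffPrime F // p.1.natDegree - 1 = d} ≤ Nat.card F ^ (d + 1) := by
  rw [← card_monic_natDegree]
  exact Nat.card_le_card_of_injective
    (fun p => ⟨p.1.1, p.1.2.1, by have := p.1.2.2.1.natDegree_pos; have := p.2; omega⟩)
    fun p r h => Subtype.ext (Subtype.ext (congrArg (fun r => r.1) h))

theorem card_affPrime_fiber (F : Type) [Field F] [Fintype F] (d : ℕ) :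
    Nat.card {p : AffPrime F // p.1.natDegree - 1 = d} = numIrred' F (d + 1) := by
  classical
  let A : Set F[X] := {p | p.Monic ∧ Irreducible p ∧ p.natDegree = d + 1}
  have hA : A.Finite :=
    Set.Finite.subset (s := {p : F[X] | p.Monic ∧ p.natDegree = d + 1})
      (instFiniteMonicDegree (F := F) (d + 1)) fun p hp => ⟨hp.1, hp.2.2⟩
  let e : {p : AffPrime F // p.1.natDegree - 1 = d} ≃ (A \ {X, X - C 1} : Set F[X]) :=
    { toFun := fun p => ⟨p.1.1, ⟨p.1.2.1, p.1.2.2.1, by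
          have := p.1.2.2.1.natDegree_pos; have := p.2; omega⟩, by
          simpa using p.1.2.2.2⟩
      invFun := fun p => ⟨⟨p.1, p.2.1.1, p.2.1.2.1, by simpa using p.2.2⟩, by
          change p.1.natDegree - 1 = d
          rw [p.2.1.2.2, Nat.add_sub_cancel]⟩
      left_inv := fun p => rfl
      right_inv := fun p => rfl }
  have hnum : numIrred F (d + 1) = A.ncard := rfl
  rw [Nat.card_congr e, Nat.card_coe_set_eq, numIrred']
  split_ifs with hd
  · have hpair : ({X, X - C 1} : Set F[X]) ⊆ A := by
      rintro p (rfl | rfl)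
      · exact ⟨monic_X, irreducible_X, by rw [natDegree_X, hd]⟩
      · exact ⟨monic_X_sub_C 1, irreducible_X_sub_C 1, by rw [natDegree_X_sub_C, hd]⟩
    have hne : (X : F[X]) ≠ X - C 1 := by
      intro h
      simpa using congrArg (eval 0) h
    rw [Set.ncard_sdiff hpair (hA.subset hpair), Set.ncard_pair hne, ← hnum, hd]
  · rw [hnum, sdiff_eq_left.2]
    rw [Set.disjoint_left]
    rintro p hp (rfl | rfl)
    · exact hd (by rw [← hp.2.2, natDegree_X])
    · exact hd (by rw [← hp.2.2, natDegree_X_sub_C])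

theorem summable_affPrime (F : Type) [Field F] [Fintype F] {u : ℝ} (hu0 : 0 < u) (hu1 : u < 1) :
    Summable fun p : AffPrime F =>
      u ^ p.1.natDegree / ((Fintype.card F : ℝ) ^ p.1.natDegree - 1) := by
  have hq : (2 : ℝ) ≤ Fintype.card F := by exact_mod_cast Fintype.one_lt_card (α := F)
  have hpow : ∀ d : ℕ, 2 ≤ (Fintype.card F : ℝ) ^ (d + 1) := fun d =>
    hq.trans (le_self_pow₀ (by linarith) (Nat.succ_ne_zero d))
  rw [← (Equiv.sigmaFiberEquiv fun p : AffPrime F => p.1.natDegree - 1).summable_iff]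
  have hval : ∀ (d : ℕ) (p : {p : AffPrime F // p.1.natDegree - 1 = d}),
      p.1.1.natDegree = d + 1 := fun d p => by
    have := p.1.2.2.1.natDegree_pos; have := p.2; omega
  rw [summable_sigma_of_nonneg]
  · refine ⟨fun d => Summable.of_finite, ?_⟩
    refine Summable.of_nonneg_of_le (f := fun d => 2 * u * u ^ d) (fun d => tsum_nonneg fun p => ?_)
      (fun d => ?_) ((summable_geometric_of_lt_one hu0.le hu1).mul_left _)
    · simp only [Function.comp, Equiv.sigmaFiberEquiv_apply, hval d p]
      exact div_nonneg (by positivity) (by linarith [hpow d])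
    · simp only [Function.comp, Equiv.sigmaFiberEquiv_apply, hval d]
      rw [tsum_const, nsmul_eq_mul]
      have hcard : (Nat.card {p : AffPrime F // p.1.natDegree - 1 = d} : ℝ) ≤
          (Fintype.card F : ℝ) ^ (d + 1) := by
        exact_mod_cast Nat.card_eq_fintype_card (α := F) ▸ card_affPrime_fiber_le F d
      have h1 := hpow d
      calc _ ≤ (Fintype.card F : ℝ) ^ (d + 1) *
            (u ^ (d + 1) / ((Fintype.card F : ℝ) ^ (d + 1) - 1)) :=
            mul_le_mul_of_nonneg_right hcard (div_nonneg (by positivity) (by linarith))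
        _ ≤ 2 * u * u ^ d := by
          rw [← mul_div_assoc, div_le_iff₀ (by linarith), pow_succ u]
          have : 0 < u ^ d * u := by positivity
          nlinarith
  · rintro ⟨d, p⟩
    simp only [Function.comp, Equiv.sigmaFiberEquiv_apply, hval d p]
    exact div_nonneg (by positivity) (by linarith [hpow d])

end

/-- Generating function for separable elements of `A(n,q)`:
`Σ_{n=0}^∞ s_A(n,q) u^n = ∏_{d=1}^∞ (1 + u^d/(q^d - 1))^{N'(d,q)}`. -/
theorem affine_separable_genfun (F : Type) [Field F] [Fintype F] (q : ℕ)
    (hq : q = Fintype.card F) (u : ℝ) (hu0 : 0 < u) (hu1 : u < 1) :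
    HasSum (fun n : ℕ => sA F n * u ^ n)
      (∏' d : ℕ, (1 + u ^ (d + 1) / ((q : ℝ) ^ (d + 1) - 1)) ^ numIrred' F (d + 1)) := by
  subst hq
  have hsum := summable_affPrime F hu0 hu1
  have hone : ∀ d : ℕ, 1 ≤ (Fintype.card F : ℝ) ^ d := fun d =>
    one_le_pow₀ (by exact_mod_cast Fintype.card_pos (α := F))
  obtain ⟨Z, hZ⟩ := summable_finsetProd_of_summable_nonneg
    (fun p => div_nonneg (pow_nonneg hu0.le _) (sub_nonneg.2 (hone _))) hsum
  have hprod := hasProd_one_add_of_hasSum_prod hZ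
  rw [← (Equiv.sigmaFiberEquiv fun p : AffPrime F => p.1.natDegree - 1).hasProd_iff] at hprod
  have hprod' := hprod.sigma (g := fun d : ℕ =>
    (1 + u ^ (d + 1) / ((Fintype.card F : ℝ) ^ (d + 1) - 1)) ^ numIrred' F (d + 1)) fun d => by
      cases nonempty_fintype {p : AffPrime F // p.1.natDegree - 1 = d}
      convert! hasProd_fintype _
      rw [← card_affPrime_fiber, Nat.card_eq_fintype_card]
      symm
      refine Finset.prod_eq_pow_card fun p _ => ?_
      have : p.1.1.natDegree = d + 1 := by
        have := p.1.2.2.1.natDegree_pos; have := p.2; omega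
      simp only [Function.comp, Equiv.sigmaFiberEquiv_apply, this]
  rw [hprod'.tprod_eq]
  rw [← (Equiv.sigmaFiberEquiv (affDegree (F := F))).hasSum_iff] at hZ
  refine hZ.sigma fun n => ?_
  convert! (hasSum_sA F n).mul_right (u ^ n) using 2 with S
  simp only [Function.comp, Equiv.sigmaFiberEquiv_apply]
  rw [show u ^ n = u ^ affDegree S.1 by rw [S.2], affDegree, ← Finset.prod_pow_eq_pow_sum,
    ← Finset.prod_mul_distrib]
  exact Finset.prod_congr rfl fun p _ => by rw [div_eq_mul_inv, mul_comm]
end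

section
/- Let q be a prime power. For every n ≥ 1, the proportion of separable elements of GL(n, F_q) equals the proportion of separable elements of A(n,q) plus 1/(q−1) times the proportion of separable elements of A(n−1,q); that is, s_GL(n,q) = s_A(n,q) + s_A(n−1,q)/(q−1). -/
open Matrix

/-- `s_GL(n,q)`: the proportion of separable elements of `GL(n, F_q)`. -/
noncomputable def sGL (F : Type) [Field F] [Fintype F] (n : ℕ) : ℝ :=
  (Nat.card {x : GL (Fin n) F // Squarefree x.val.charpoly} : ℝ) /
    (Nat.card (GL (Fin n) F) : ℝ)

open Polynomial in
theorem Polynomial.rootMultiplicity_le_one_of_squarefree {F : Type*} [Field F] {p : F[X]}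
    (hp : Squarefree p) (a : F) : p.rootMultiplicity a ≤ 1 := by
  by_contra! h
  have h2 : (X - C a) * (X - C a) ∣ p := by
    rw [← sq]
    exact (pow_dvd_pow _ h).trans (pow_rootMultiplicity_dvd p a)
  exact not_isUnit_X_sub_C a (hp _ h2)

open Polynomial in
theorem Polynomial.squarefree_X_sub_C_mul_iff {F : Type*} [Field F] (p : F[X]) (a : F) :
    Squarefree ((X - C a) * p) ↔ Squarefree p ∧ ¬ p.IsRoot a := by
  have hirr : Irreducible (X - C a) := irreducible_X_sub_C a
  rw [squarefree_mul_iff, hirr.isRelPrime_iff_not_dvd, dvd_iff_isRoot]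
  exact ⟨fun h => ⟨h.2.2, h.1⟩, fun h => ⟨h.2, hirr.squarefree, h.1⟩⟩

section AffineGroup

variable {F : Type} [Field F] {n : ℕ}

theorem isAff_iff_mulVec_single (x : GL (Fin (n + 1)) F) :
    IsAff x ↔ x.val *ᵥ Pi.single 0 1 = Pi.single 0 1 := by
  rw [mulVec_single_one, funext_iff, Fin.forall_fin_succ, IsAff, Fin.forall_fin_succ]
  simp [Fin.succ_ne_zero]

theorem exists_GL_mulVec_single (v : Fin (n + 1) → F) (hv : v ≠ 0) :
    ∃ g : GL (Fin (n + 1)) F, g.val *ᵥ Pi.single 0 1 = v := by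
  have he : (Pi.single 0 1 : Fin (n + 1) → F) ≠ 0 := by simp
  let f := (LinearEquiv.toSpanNonzeroSingleton F (Fin (n + 1) → F) _ he).symm ≪≫ₗ
    LinearEquiv.toSpanNonzeroSingleton F (Fin (n + 1) → F) v hv
  obtain ⟨g, hg⟩ := Submodule.exists_linearEquiv_restrict_eq f
  have hgv : g (Pi.single 0 1) = v := by
    have h := hg (LinearEquiv.toSpanNonzeroSingleton F (Fin (n + 1) → F) _ he 1)
    simp only [f, LinearEquiv.trans_apply, LinearEquiv.symm_apply_apply] at h
    simpa [LinearEquiv.toSpanNonzeroSingleton] using h.symm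
  refine ⟨GeneralLinearGroup.toLin.symm (LinearMap.GeneralLinearGroup.ofLinearEquiv g), ?_⟩
  have h : GeneralLinearGroup.toLin (GeneralLinearGroup.toLin.symm
      (LinearMap.GeneralLinearGroup.ofLinearEquiv g)) =
      LinearMap.GeneralLinearGroup.ofLinearEquiv g := by simp
  have h2 := congrArg (fun u : LinearMap.GeneralLinearGroup F (Fin (n + 1) → F) =>
    u.val (Pi.single 0 1)) h
  simp only [GeneralLinearGroup.coe_toLin, mulVecLin_apply] at h2
  exact h2.trans hgv

theorem GL_inv_mulVec_eq_iff {ι : Type*} [Fintype ι] [DecidableEq ι] (g : GL ι F) (v w : ι → F) :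
    (g⁻¹).val *ᵥ v = w ↔ v = g.val *ᵥ w := by
  constructor
  · rintro rfl
    rw [mulVec_mulVec, ← Units.val_mul, mul_inv_cancel, Units.val_one, one_mulVec]
  · rintro rfl
    rw [mulVec_mulVec, ← Units.val_mul, inv_mul_cancel, Units.val_one, one_mulVec]

theorem GL_mulVec_ne_zero {ι : Type*} [Fintype ι] [DecidableEq ι] (g : GL ι F) {v : ι → F}
    (hv : v ≠ 0) : g.val *ᵥ v ≠ 0 := by
  intro h
  have := (GL_inv_mulVec_eq_iff g 0 v).2 h.symm
  exact hv (by simpa using this.symm)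

/-- Orbit-stabilizer for the action of `GL` on nonzero vectors. -/
theorem card_GL_eq_card_ne_zero_mul_card_isAff :
    Nat.card (GL (Fin (n + 1)) F) =
      Nat.card {v : Fin (n + 1) → F // v ≠ 0} * Nat.card {x : GL (Fin (n + 1)) F // IsAff x} := by
  choose t ht using fun v : {v : Fin (n + 1) → F // v ≠ 0} => exists_GL_mulVec_single v.1 v.2
  rw [← Nat.card_prod]
  have he : (Pi.single 0 1 : Fin (n + 1) → F) ≠ 0 := by simp
  have key : ∀ v, ∀ a : GL (Fin (n + 1)) F, IsAff a →
      (t v * a).val *ᵥ Pi.single 0 1 = v.1 := fun v a ha => by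
    rw [Units.val_mul, ← mulVec_mulVec, (isAff_iff_mulVec_single a).1 ha, ht]
  refine Nat.card_congr
    { toFun := fun g => (⟨g.val *ᵥ Pi.single 0 1, GL_mulVec_ne_zero g he⟩,
        ⟨(t ⟨g.val *ᵥ Pi.single 0 1, GL_mulVec_ne_zero g he⟩)⁻¹ * g, ?_⟩)
      invFun := fun p => t p.1 * p.2.1
      left_inv := fun g => by simp
      right_inv := ?_ }
  · rw [isAff_iff_mulVec_single, Units.val_mul, ← mulVec_mulVec, GL_inv_mulVec_eq_iff, ht]
  · rintro ⟨v, a, ha⟩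
    have h1 : (⟨(t v * a).val *ᵥ Pi.single 0 1, GL_mulVec_ne_zero _ he⟩ :
        {v : Fin (n + 1) → F // v ≠ 0}) = v := Subtype.ext (key v a ha)
    simp only [h1, inv_mul_cancel_left]

theorem charpoly_GL_conj {ι : Type*} [Fintype ι] [DecidableEq ι] (g x : GL ι F) :
    (g * x * g⁻¹).val.charpoly = x.val.charpoly := by
  have h : (g * x * g⁻¹).val = g.val * x.val * g.val⁻¹ := by simp
  rw [h, charpoly_units_conj]

/-- Pairs of a nonzero vector and a separable matrix fixing it, counted by the vector. -/
theorem card_separable_fixing :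
    Nat.card {p : {v : Fin (n + 1) → F // v ≠ 0} × GL (Fin (n + 1)) F //
        Squarefree p.2.val.charpoly ∧ p.2.val *ᵥ p.1.1 = p.1.1} =
      Nat.card {v : Fin (n + 1) → F // v ≠ 0} *
        Nat.card {x : GL (Fin (n + 1)) F // IsAff x ∧ Squarefree x.val.charpoly} := by
  choose t ht using fun v : {v : Fin (n + 1) → F // v ≠ 0} => exists_GL_mulVec_single v.1 v.2
  rw [← Nat.card_prod]
  refine Nat.card_congr
    { toFun := fun p => (p.1.1, ⟨(t p.1.1)⁻¹ * p.1.2 * t p.1.1, ?_, ?_⟩)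
      invFun := fun p => ⟨(p.1, t p.1 * p.2.1 * (t p.1)⁻¹), ?_, ?_⟩
      left_inv := fun p => by
        ext1
        simp [mul_assoc]
      right_inv := fun p => by simp [mul_assoc] }
  · rw [isAff_iff_mulVec_single, mul_assoc, Units.val_mul, ← mulVec_mulVec, GL_inv_mulVec_eq_iff,
      Units.val_mul, ← mulVec_mulVec, ht, p.2.2]
  · have h := charpoly_GL_conj (t p.1.1)⁻¹ p.1.2
    rw [inv_inv] at h
    rw [h]
    exact p.2.1
  · rw [charpoly_GL_conj]
    exact p.2.2.2
  · have h : ((t p.1)⁻¹).val *ᵥ p.1.1 = Pi.single 0 1 := by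
      rw [GL_inv_mulVec_eq_iff, ht]
    simp only [Units.val_mul] at h ⊢
    rw [← mulVec_mulVec, ← mulVec_mulVec, h, (isAff_iff_mulVec_single _).1 p.2.2.1, ht]

theorem card_fixed_ne_zero [Finite F] {ι : Type*} [Fintype ι] [DecidableEq ι] (g : Matrix ι ι F)
    (hs : Squarefree g.charpoly) (hr : g.charpoly.IsRoot 1) :
    Nat.card {v : ι → F // v ≠ 0 ∧ g *ᵥ v = v} = Nat.card F - 1 := by
  have := Fintype.ofFinite F
  rw [← charpoly_toLin'] at hs hr
  have hle := (LinearMap.finrank_eigenspace_le (Matrix.toLin' g) 1).trans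
    (Polynomial.rootMultiplicity_le_one_of_squarefree hs 1)
  obtain ⟨v, hv⟩ := ((Module.End.hasEigenvalue_iff_isRoot_charpoly _ _).2 hr).exists_hasEigenvector
  have hfix : g *ᵥ v = v := by simpa using hv.apply_eq_smul
  rw [← Nat.card_units]
  symm
  refine Nat.card_congr (Equiv.ofBijective
    (fun c : Fˣ => ⟨c.1 • v, smul_ne_zero c.ne_zero hv.2, by rw [mulVec_smul, hfix]⟩) ⟨?_, ?_⟩)
  · intro a b h
    exact Units.ext (smul_left_injective F hv.2 (congrArg Subtype.val h))
  · rintro ⟨w, hw, hgw⟩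
    have hwm : w ∈ Module.End.eigenspace (Matrix.toLin' g) 1 := by
      rw [Module.End.mem_eigenspace_iff]
      simpa using hgw
    obtain ⟨⟨u, hum⟩, hu⟩ := finrank_le_one_iff.1 hle
    obtain ⟨a, ha⟩ := hu ⟨v, hv.1⟩
    obtain ⟨b, hb⟩ := hu ⟨w, hwm⟩
    have ha : a • u = v := congrArg Subtype.val ha
    have hb : b • u = w := congrArg Subtype.val hb
    have ha0 : a ≠ 0 := by rintro rfl; exact hv.2 (by simp [← ha])
    have hb0 : b ≠ 0 := by rintro rfl; exact hw (by simp [← hb])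
    refine ⟨Units.mk0 (b / a) (div_ne_zero hb0 ha0), Subtype.ext ?_⟩
    simp [← ha, ← hb, smul_smul, div_mul_cancel₀ b ha0]

/-- Pairs of a nonzero vector and a separable matrix fixing it, counted by the matrix. -/
theorem card_separable_fixing' [Finite F] :
    Nat.card {p : {v : Fin (n + 1) → F // v ≠ 0} × GL (Fin (n + 1)) F //
        Squarefree p.2.val.charpoly ∧ p.2.val *ᵥ p.1.1 = p.1.1} =
      Nat.card {x : GL (Fin (n + 1)) F // Squarefree x.val.charpoly ∧ x.val.charpoly.IsRoot 1} *
        (Nat.card F - 1) := by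
  have e : {p : {v : Fin (n + 1) → F // v ≠ 0} × GL (Fin (n + 1)) F //
        Squarefree p.2.val.charpoly ∧ p.2.val *ᵥ p.1.1 = p.1.1} ≃
      Σ x : {x : GL (Fin (n + 1)) F // Squarefree x.val.charpoly ∧ x.val.charpoly.IsRoot 1},
        {v : Fin (n + 1) → F // v ≠ 0 ∧ x.1.val *ᵥ v = v} :=
    { toFun := fun p => ⟨⟨p.1.2, p.2.1, by
          rw [← charpoly_toLin', ← Module.End.hasEigenvalue_iff_isRoot_charpoly]
          refine Module.End.hasEigenvalue_of_hasEigenvector (x := p.1.1.1) ⟨?_, p.1.1.2⟩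
          rw [Module.End.mem_eigenspace_iff]
          simpa using p.2.2⟩, ⟨p.1.1.1, p.1.1.2, p.2.2⟩⟩
      invFun := fun s => ⟨(⟨s.2.1, s.2.2.1⟩, s.1.1), s.1.2.1, s.2.2.2⟩
      left_inv := fun _ => rfl
      right_inv := fun _ => rfl }
  have := Fintype.ofFinite
    {x : GL (Fin (n + 1)) F // Squarefree x.val.charpoly ∧ x.val.charpoly.IsRoot 1}
  rw [Nat.card_congr e, Nat.card_sigma,
    Finset.sum_congr rfl fun x _ => card_fixed_ne_zero x.1.val x.2.1 x.2.2]
  rw [Finset.sum_const, Finset.card_univ, smul_eq_mul,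
    Nat.card_eq_fintype_card (α := {x : GL (Fin (n + 1)) F // _ ∧ _})]

theorem charpoly_of_col_zero_s11 (M : Matrix (Fin (n + 1)) (Fin (n + 1)) F) (h0 : M 0 0 = 1)
    (h : ∀ j : Fin (n + 1), j ≠ 0 → M j 0 = 0) :
    M.charpoly = (Polynomial.X - Polynomial.C 1) * (M.submatrix Fin.succ Fin.succ).charpoly := by
  rw [charpoly, det_succ_column_zero, Fin.sum_univ_succ, Finset.sum_eq_zero]
  · have : (M.charmatrix.submatrix Fin.succ Fin.succ) =
        (M.submatrix Fin.succ Fin.succ).charmatrix := by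
      ext i j : 2
      simp [charmatrix_apply, diagonal_apply]
    simp only [Fin.succAbove_zero, this]
    simp [charpoly, h0]
  · intro i _
    rw [charmatrix_apply_ne _ _ _ (Fin.succ_ne_zero i), h _ (Fin.succ_ne_zero i)]
    simp

theorem det_of_col_zero_s11 (M : Matrix (Fin (n + 1)) (Fin (n + 1)) F) (h0 : M 0 0 = 1)
    (h : ∀ j : Fin (n + 1), j ≠ 0 → M j 0 = 0) :
    M.det = (M.submatrix Fin.succ Fin.succ).det := by
  rw [det_succ_column_zero, Fin.sum_univ_succ, Finset.sum_eq_zero]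
  · simp [h0, Fin.succAbove_zero]
  · intro i _
    rw [h _ (Fin.succ_ne_zero i)]
    simp

/-- The matrix with first row `(1, v)`, zeros below the corner, and lower right block `M`. -/
def affMatrix (v : Fin n → F) (M : Matrix (Fin n) (Fin n) F) :
    Matrix (Fin (n + 1)) (Fin (n + 1)) F :=
  Matrix.of (Fin.cons (Fin.cons 1 v) fun i => Fin.cons 0 (M i))

theorem affMatrix_succ_zero (v : Fin n → F) (M : Matrix (Fin n) (Fin n) F) (j : Fin (n + 1))
    (hj : j ≠ 0) : affMatrix v M j 0 = 0 := by
  obtain ⟨i, rfl⟩ := Fin.exists_succ_eq.2 hj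
  rfl

theorem affMatrix_submatrix (v : Fin n → F) (M : Matrix (Fin n) (Fin n) F) :
    (affMatrix v M).submatrix Fin.succ Fin.succ = M := rfl

/-- An element of the affine group amounts to a translation part and a linear part. -/
noncomputable def isAffEquiv :
    {x : GL (Fin (n + 1)) F // IsAff x} ≃ (Fin n → F) × GL (Fin n) F where
  toFun x := (fun i => x.1.val 0 i.succ,
    GeneralLinearGroup.mkOfDetNeZero (x.1.val.submatrix Fin.succ Fin.succ) (by
      rw [← det_of_col_zero_s11 _ x.2.1 x.2.2]
      exact ((isUnit_iff_isUnit_det _).1 x.1.isUnit).ne_zero))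
  invFun p := ⟨GeneralLinearGroup.mkOfDetNeZero (affMatrix p.1 p.2.val) (by
      rw [det_of_col_zero_s11 _ rfl (affMatrix_succ_zero _ _), affMatrix_submatrix]
      exact ((isUnit_iff_isUnit_det _).1 p.2.isUnit).ne_zero),
    rfl, affMatrix_succ_zero _ _⟩
  left_inv x := by
    refine Subtype.ext (Units.ext ?_)
    change affMatrix (fun i => x.1.val 0 i.succ) (x.1.val.submatrix Fin.succ Fin.succ) = x.1.val
    ext i j
    refine Fin.cases ?_ (fun i => ?_) i <;> refine Fin.cases ?_ (fun j => ?_) j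
    · exact x.2.1.symm
    · rfl
    · exact (x.2.2 _ (Fin.succ_ne_zero i)).symm
    · rfl
  right_inv p := Prod.ext rfl (Units.ext rfl)

theorem card_isAff [Finite F] :
    Nat.card {x : GL (Fin (n + 1)) F // IsAff x} =
      Nat.card (Fin n → F) * Nat.card (GL (Fin n) F) := by
  rw [Nat.card_congr isAffEquiv, Nat.card_prod]

theorem card_isAff_separable [Finite F] :
    Nat.card {x : GL (Fin (n + 1)) F // IsAff x ∧ Squarefree x.val.charpoly} =
      Nat.card (Fin n → F) * Nat.card {x : GL (Fin n) F //
        Squarefree x.val.charpoly ∧ ¬ x.val.charpoly.IsRoot 1} := by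
  rw [← Nat.card_prod]
  have e1 := Equiv.subtypeSubtypeEquivSubtypeInter (fun x : GL (Fin (n + 1)) F => IsAff x)
    (fun x => Squarefree x.val.charpoly)
  have e2 : {x : {x : GL (Fin (n + 1)) F // IsAff x} // Squarefree x.1.val.charpoly} ≃
      {p : (Fin n → F) × GL (Fin n) F //
        Squarefree p.2.val.charpoly ∧ ¬ p.2.val.charpoly.IsRoot 1} :=
    isAffEquiv.subtypeEquiv fun x => by
      rw [charpoly_of_col_zero_s11 _ x.2.1 x.2.2, Polynomial.squarefree_X_sub_C_mul_iff]
      rfl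
  refine Nat.card_congr ((e1.symm.trans e2).trans
    { toFun := fun p => (p.1.1, ⟨p.1.2, p.2⟩)
      invFun := fun p => ⟨(p.1, p.2.1), p.2.2⟩
      left_inv := fun _ => rfl
      right_inv := fun _ => rfl })

theorem sA_eq [Fintype F] (n : ℕ) :
    sA F n = (Nat.card {x : GL (Fin n) F //
      Squarefree x.val.charpoly ∧ ¬ x.val.charpoly.IsRoot 1} : ℝ) / Nat.card (GL (Fin n) F) := by
  have h : (Nat.card (Fin n → F) : ℝ) ≠ 0 := Nat.cast_ne_zero.2 Nat.card_pos.ne'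
  rw [sA, card_isAff, card_isAff_separable]
  push_cast
  rw [mul_div_mul_left _ _ h]

theorem sA_div_eq [Fintype F] (n : ℕ) :
    sA F n / ((Fintype.card F : ℝ) - 1) = (Nat.card {x : GL (Fin (n + 1)) F //
      Squarefree x.val.charpoly ∧ x.val.charpoly.IsRoot 1} : ℝ) /
        Nat.card (GL (Fin (n + 1)) F) := by
  have hq : (Fintype.card F : ℝ) - 1 ≠ 0 :=
    (sub_pos.2 (by exact_mod_cast Fintype.one_lt_card (α := F))).ne'
  have hA : (Nat.card {x : GL (Fin (n + 1)) F // IsAff x} : ℝ) ≠ 0 := by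
    rw [card_isAff]
    exact Nat.cast_ne_zero.2 (mul_pos Nat.card_pos Nat.card_pos).ne'
  have hK : (Nat.card {v : Fin (n + 1) → F // v ≠ 0} : ℝ) ≠ 0 := by
    have : Nonempty {v : Fin (n + 1) → F // v ≠ 0} := ⟨⟨1, one_ne_zero⟩⟩
    exact Nat.cast_ne_zero.2 Nat.card_pos.ne'
  have h := congrArg (Nat.cast (R := ℝ))
    ((card_separable_fixing' (F := F) (n := n)).symm.trans card_separable_fixing)
  rw [Nat.cast_mul, Nat.cast_mul, Nat.cast_sub Nat.card_pos, Nat.card_eq_fintype_card (α := F),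
    Nat.cast_one] at h
  rw [sA, card_GL_eq_card_ne_zero_mul_card_isAff, Nat.cast_mul, div_div,
    div_eq_div_iff (mul_ne_zero hA hq) (mul_ne_zero hK hA)]
  linear_combination -(Nat.card {x : GL (Fin (n + 1)) F // IsAff x} : ℝ) * h

end AffineGroup

/-- For `n ≥ 1`, `s_GL(n,q) = s_A(n,q) + s_A(n-1,q)/(q-1)`. -/
theorem separable_GL_affine_relation (F : Type) [Field F] [Fintype F] (q : ℕ)
    (hq : q = Fintype.card F) (n : ℕ) (hn : 1 ≤ n) :
    sGL F n = sA F n + sA F (n - 1) / ((q : ℝ) - 1) := by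
  subst hq
  obtain ⟨m, rfl⟩ : ∃ m, n = m + 1 := ⟨n - 1, by omega⟩
  classical
  rw [Nat.add_sub_cancel, sA_div_eq, sA_eq, sGL, ← add_div, ← Nat.cast_add, ← Nat.card_sum]
  congr 2
  refine (Nat.card_congr ?_).symm
  refine ((Equiv.subtypeSubtypeEquivSubtypeInter _ _).symm.sumCongr
    (Equiv.subtypeSubtypeEquivSubtypeInter _ _).symm).trans ?_
  exact (Equiv.sumComm _ _).trans (Equiv.sumCompl _)
end
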